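/- arXiv:2605.04889 — 2 statements merged into one kernel-verified Lean document; each statement's English description precedes it below -/
import Mathlib

section
/- Let k and a be integers with 1 ≤ a ≤ k and k ≢ a (mod 2). For a nonnegative integer n, let W_{k,a}(n) denote the number of partitions λ of n such that f_1(λ) ≤ a−1, f_i(λ)+f_{i+1}(λ) ≤ k−1 for every i ≥ 1, and every even part appears an even number of times (i.e., f_{2j}(λ) is even for all j ≥ 1). Then for every complex number q with |q| < 1, ∑_{n ≥ 0} W_{k,a}(n) q^n = ∑_{N_1 ≥ N_2 ≥ ⋯ ≥ N_{k−1} ≥ 0} q^{N_1² + N_2² + ⋯ + N_{k−1}² + 2N_a + 2N_{a+2} + ⋯ + 2N_{k−1}} / ((q²;q²)_{N_1−N_2} ⋯ (q²;q²)_{N_{k−2}−N_{k−1}} (q²;q²)_{N_{k−1}}), where the subscripts a, a+2, …, k−1 increase in steps of 2 and the sum converges absolutely. -/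
open Finset

/-- Finite q-Pochhammer symbol `(x;q)_n`. -/
noncomputable def qPoch (q x : ℂ) (n : ℕ) : ℂ :=
  ∏ j ∈ Finset.range n, (1 - x * q ^ j)

/-- Extend a tuple `N : Fin m → ℕ` (listing `N_1, …, N_m`, 1-based) to `ℕ`, with value
`0` for indices `> m`. -/
def ext (m : ℕ) (N : Fin m → ℕ) (i : ℕ) : ℕ :=
  if h : i - 1 < m then N ⟨i - 1, h⟩ else 0

/-- Summand of the Kurşungöz multisum when `k ≢ a (mod 2)`: exponent
`N_1² + ⋯ + N_{k-1}² + 2N_a + 2N_{a+2} + ⋯ + 2N_{k-1}`, denominator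
`(q²;q²)_{N_1-N_2} ⋯ (q²;q²)_{N_{k-2}-N_{k-1}} (q²;q²)_{N_{k-1}}`. -/
noncomputable def kurTerm (k a : ℕ) (q : ℂ) (N : Fin (k - 1) → ℕ) : ℂ :=
  q ^ ((∑ i ∈ Finset.Icc 1 (k - 1), (ext (k - 1) N i) ^ 2) +
        ∑ i ∈ (Finset.Icc a (k - 1)).filter (fun i => i % 2 = a % 2),
          2 * ext (k - 1) N i) /
    ∏ i ∈ Finset.Icc 1 (k - 1), qPoch (q ^ 2) (q ^ 2) (ext (k - 1) N i - ext (k - 1) N (i + 1))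

namespace Kursungoz

open PowerSeries

/-- The finite product `(q²;q²)_n`. -/
def sqPoch {F : Type*} [Field F] (q : F) (n : ℕ) : F :=
  ∏ j ∈ range n, (1 - q ^ 2 * (q ^ 2) ^ j)

/-- The exponent `∑ (N_i² + 2 v_i N_i)` of a linearly twisted multisum. -/
def chainExp (K : ℕ) (v N : ℕ → ℕ) : ℕ := ∑ i ∈ Icc 1 K, (N i ^ 2 + 2 * v i * N i)

/-- The summand of the multisum with linear twist `v`. -/
def chainTerm {F : Type*} [Field F] (K : ℕ) (q : F) (v N : ℕ → ℕ) : F :=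
  q ^ chainExp K v N / ∏ i ∈ Icc 1 K, sqPoch q (N i - N (i + 1))

open Classical in
/-- The sequences `N_1 ≥ ⋯ ≥ N_K ≥ 0` (extended by `0`) with sum `m`. -/
noncomputable def chains (K m : ℕ) : Finset (ℕ → ℕ) :=
  (piAntidiag (Icc 1 K) m).filter fun N => ∀ i ∈ Icc 1 K, N (i + 1) ≤ N i

/-- The multisum with linear twist `v`, graded by `N_1 + ⋯ + N_K`. A nonzero value `v 0`
makes it vanish; with this convention `multisum_step` also holds at the boundary. -/
noncomputable def multisum (K : ℕ) (q : ℂ) (v : ℕ → ℕ) : PowerSeries ℂ :=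
  if v 0 = 0 then mk fun m => ∑ N ∈ chains K m, chainTerm K q v N else 0

/-- The indicator function of `{1, …, p}`. -/
def initSeg (p n : ℕ) : ℕ := if 1 ≤ n ∧ n ≤ p then 1 else 0

lemma mem_chains {K m : ℕ} {N : ℕ → ℕ} : N ∈ chains K m ↔
    (∑ i ∈ Icc 1 K, N i = m ∧ ∀ i, N i ≠ 0 → 1 ≤ i ∧ i ≤ K) ∧
      ∀ i, 1 ≤ i → i ≤ K → N (i + 1) ≤ N i := by
  simp [chains, mem_piAntidiag]

lemma le_of_mem_chains {K m : ℕ} {N : ℕ → ℕ} (hN : N ∈ chains K m) {l i : ℕ} (hl : 1 ≤ l)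
    (hli : l ≤ i) (hi : i ≤ K) : N i ≤ N l := by
  induction i, hli using Nat.le_induction with
  | base => exact le_rfl
  | succ i hli ih => exact ((mem_chains.1 hN).2 i (by omega) (by omega)).trans (ih (by omega))

lemma one_sub_pow_ne_zero {q : ℂ} (hq : ‖q‖ < 1) {n : ℕ} (hn : n ≠ 0) : 1 - q ^ n ≠ 0 := by
  intro h
  have h1 : ‖q ^ n‖ = 1 := by rw [← sub_eq_zero.1 h, norm_one]
  rw [norm_pow] at h1
  exact (pow_lt_one₀ (norm_nonneg q) hq hn).ne h1

lemma sqPoch_ne_zero {q : ℂ} (hq : ‖q‖ < 1) (n : ℕ) : sqPoch q n ≠ 0 := by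
  refine prod_ne_zero_iff.2 fun j _ => ?_
  have h := one_sub_pow_ne_zero hq (n := 2 * (j + 1)) (by omega)
  rwa [show q ^ (2 * (j + 1)) = q ^ 2 * (q ^ 2) ^ j by ring] at h

lemma sqPoch_succ {F : Type*} [Field F] (q : F) (n : ℕ) :
    sqPoch q (n + 1) = sqPoch q n * (1 - q ^ (2 * (n + 1))) := by
  rw [sqPoch, prod_range_succ, ← sqPoch]; ring

lemma multisum_congr {K : ℕ} {q : ℂ} {v v' : ℕ → ℕ} (h : ∀ n ≤ K, v n = v' n) :
    multisum K q v = multisum K q v' := by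
  have : ∀ N, chainTerm K q v N = chainTerm K q v' N := fun N => by
    have : chainExp K v N = chainExp K v' N :=
      sum_congr rfl fun i hi => by rw [h i (mem_Icc.1 hi).2]
    rw [chainTerm, chainTerm, this]
  simp only [multisum, this, h 0 (Nat.zero_le K)]

lemma sum_initSeg_mul {K i : ℕ} (hi : i ≤ K) (f : ℕ → ℕ) :
    ∑ l ∈ Icc 1 K, initSeg i l * f l = ∑ l ∈ Icc 1 i, f l := by
  simp only [initSeg, ite_mul, one_mul, zero_mul]
  rw [← sum_filter]
  refine sum_congr ?_ fun _ _ => rfl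
  ext l
  simp only [mem_filter, mem_Icc]
  omega

lemma sum_single_mul {K i : ℕ} (N : ℕ → ℕ) (hN : ∀ i, N i ≠ 0 → 1 ≤ i ∧ i ≤ K) :
    ∑ l ∈ Icc 1 K, (if l = i then 1 else 0) * N l = N i := by
  simp only [ite_mul, one_mul, zero_mul, sum_ite_eq', mem_Icc]
  split_ifs with h
  · rfl
  · by_contra h'
    exact h (hN i (Ne.symm h'))

lemma chainExp_shift {K i : ℕ} {v v' N : ℕ → ℕ}
    (hN : ∀ i, N i ≠ 0 → 1 ≤ i ∧ i ≤ K)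
    (h : ∀ n, v' n + (if n = i + 1 then 1 else 0) = v n + (if n = i then 1 else 0)) :
    chainExp K v' N + 2 * N (i + 1) = chainExp K v N + 2 * N i := by
  rw [← sum_single_mul (i := i) N hN, ← sum_single_mul (i := i + 1) N hN, chainExp, chainExp,
    mul_sum, mul_sum, ← sum_add_distrib, ← sum_add_distrib]
  refine sum_congr rfl fun n _ => ?_
  linear_combination (2 * N n) * h n

lemma chainExp_add_initSeg {K i : ℕ} {v M : ℕ → ℕ} (hi : i ≤ K) :
    chainExp K v (fun n => M n + initSeg i n) =
      chainExp K (fun n => v n + initSeg i n) M + (i + 2 * ∑ n ∈ Icc 1 i, v n) := by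
  have h1 : i = ∑ l ∈ Icc 1 K, initSeg i l * 1 := by rw [sum_initSeg_mul hi]; simp
  rw [← sum_initSeg_mul hi v, mul_sum, chainExp, chainExp]
  conv_rhs => enter [2, 1]; rw [h1]
  rw [← sum_add_distrib, ← sum_add_distrib]
  refine sum_congr rfl fun n _ => ?_
  have : initSeg i n = 0 ∨ initSeg i n = 1 := by unfold initSeg; split_ifs <;> simp
  rcases this with h | h <;> rw [h] <;> ring

lemma chainTerm_add_initSeg {K i m : ℕ} {q : ℂ} (hq : ‖q‖ < 1) {v M : ℕ → ℕ} (hi : 1 ≤ i)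
    (hiK : i ≤ K) (hM : M ∈ chains K m) :
    chainTerm K q v (fun n => M n + initSeg i n) * (1 - q ^ (2 * (M i - M (i + 1) + 1))) =
      q ^ (i + 2 * ∑ n ∈ Icc 1 i, v n) * chainTerm K q (fun n => v n + initSeg i n) M := by
  have hmem : i ∈ Icc 1 K := mem_Icc.2 ⟨hi, hiK⟩
  have hMi := (mem_chains.1 hM).2 i hi hiK
  have hprod : ∏ n ∈ Icc 1 K, sqPoch q (M n + initSeg i n - (M (n + 1) + initSeg i (n + 1))) =
      (∏ n ∈ Icc 1 K, sqPoch q (M n - M (n + 1))) * (1 - q ^ (2 * (M i - M (i + 1) + 1))) := by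
    rw [← mul_prod_erase (Icc 1 K) (fun n => sqPoch q (M n - M (n + 1))) hmem,
      ← mul_prod_erase (Icc 1 K) 
        (fun n => sqPoch q (M n + initSeg i n - (M (n + 1) + initSeg i (n + 1)))) hmem, mul_right_comm,
      ← sqPoch_succ]
    refine congrArg₂ _ (congrArg _ ?_) (prod_congr rfl fun n hn => ?_)
    · simp only [initSeg]
      split_ifs <;> omega
    · rw [mem_erase, mem_Icc] at hn
      congr 1
      simp only [initSeg]
      split_ifs <;> omega
  have hne := one_sub_pow_ne_zero hq (n := 2 * (M i - M (i + 1) + 1)) (by omega)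
  have hne' : ∏ n ∈ Icc 1 K, sqPoch q (M n - M (n + 1)) ≠ 0 :=
    prod_ne_zero_iff.2 fun _ _ => sqPoch_ne_zero hq _
  rw [chainTerm, chainTerm, hprod, chainExp_add_initSeg hiK, pow_add]
  field_simp

lemma add_initSeg_mem_chains {K i m : ℕ} {M : ℕ → ℕ} (hiK : i ≤ K)
    (hM : M ∈ chains K m) : (fun n => M n + initSeg i n) ∈ chains K (m + i) := by
  rw [mem_chains] at hM ⊢
  obtain ⟨⟨h1, h2⟩, h3⟩ := hM
  refine ⟨⟨?_, fun n hn => ?_⟩, fun n hn hnK => ?_⟩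
  · have := sum_initSeg_mul hiK fun _ => 1
    simp only [mul_one, sum_const, Nat.card_Icc, smul_eq_mul] at this
    rw [sum_add_distrib, h1, this]
    omega
  · have := h2 n
    unfold initSeg at hn
    split_ifs at hn <;> omega
  · have := h3 n hn hnK
    unfold initSeg
    split_ifs <;> omega

lemma exists_eq_add_initSeg {K i m : ℕ} {N : ℕ → ℕ} (hi : 1 ≤ i) (hiK : i ≤ K)
    (hN : N ∈ chains K m) (hlt : N (i + 1) < N i) :
    i ≤ m ∧ ∃ M ∈ chains K (m - i), N = fun n => M n + initSeg i n := by
  have hle : ∀ n, initSeg i n ≤ N n := fun n => by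
    unfold initSeg
    split_ifs with h
    · have := le_of_mem_chains hN h.1 h.2 hiK
      omega
    · omega
  obtain ⟨⟨h1, h2⟩, h3⟩ := mem_chains.1 hN
  have hsum : ∑ n ∈ Icc 1 K, (N n - initSeg i n) + i = m := by
    have := sum_initSeg_mul hiK fun _ => 1
    simp only [mul_one, sum_const, Nat.card_Icc, smul_eq_mul] at this
    have h4 : ∑ n ∈ Icc 1 K, (N n - initSeg i n) + ∑ n ∈ Icc 1 K, initSeg i n = m := by
      rw [← sum_add_distrib, ← h1]
      exact sum_congr rfl fun n _ => Nat.sub_add_cancel (hle n)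
    omega
  refine ⟨by omega, fun n => N n - initSeg i n, mem_chains.2 ⟨⟨by omega, fun n hn => ?_⟩,
    fun n hn hnK => ?_⟩, funext fun n => (Nat.sub_add_cancel (hle n)).symm⟩
  · exact h2 n (by omega)
  · have := h3 n hn hnK
    rcases eq_or_ne n i with rfl | hne
    · simp only [initSeg]
      split_ifs <;> omega
    · simp only [initSeg]
      split_ifs <;> omega

/-- The elementary three-term recurrence: moving a unit of the twist from position `i + 1` to
position `i` costs one multisum with shifted twist. -/
lemma multisum_step {K i c : ℕ} {q : ℂ} (hq : ‖q‖ < 1) (hiK : i ≤ K) {v v' v'' : ℕ → ℕ}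
    (h : ∀ n, v' n + (if n = i + 1 then 1 else 0) = v n + (if n = i then 1 else 0))
    (h'' : ∀ n, v'' n = v n + initSeg i n) (hc : ∑ n ∈ range (i + 1), v n = c) :
    multisum K q v = multisum K q v' + C q ^ (i + 2 * c) * X ^ i * multisum K q v'' := by
  have h0 := h 0
  have h0'' : v'' 0 = v 0 := by rw [h'' 0]; simp [initSeg]
  by_cases hv : v 0 = 0
  swap
  · have : v' 0 ≠ 0 := by rw [if_neg (by omega)] at h0; omega
    simp [multisum, hv, this, h0'']
  rcases Nat.eq_zero_or_pos i with rfl | hi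
  · have hv' : v' 0 ≠ 0 := by simp at h0; omega
    have hvv : v'' = v := funext fun n => by
      rw [h'' n, initSeg, if_neg (by omega), add_zero]
    have hc0 : c = 0 := by rw [← hc]; simpa using hv
    simp [multisum, hv', hvv, hc0]
  have hv' : v' 0 = 0 := by split_ifs at h0 <;> omega
  obtain rfl : v'' = fun n => v n + initSeg i n := funext h''
  have hc' : ∑ n ∈ Icc 1 i, v n = c := by
    rw [← hc, range_eq_Ico, sum_eq_sum_Ico_succ_bot (by omega), hv, zero_add, zero_add]
    rfl
  rw [multisum, multisum, multisum, if_pos hv, if_pos hv', if_pos (h0''.trans hv)]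
  ext m
  rw [map_add, coeff_mk, coeff_mk, ← map_pow, mul_assoc, coeff_C_mul, coeff_X_pow_mul',
    ← sub_eq_iff_eq_add', ← sum_sub_distrib]
  have hterm : ∀ N ∈ chains K m, chainTerm K q v N - chainTerm K q v' N =
      chainTerm K q v N * (1 - q ^ (2 * (N i - N (i + 1)))) := fun N hN => by
    obtain ⟨⟨-, h2⟩, h3⟩ := mem_chains.1 hN
    have h4 := chainExp_shift h2 h
    have h5 : chainExp K v' N = chainExp K v N + 2 * (N i - N (i + 1)) := by
      have := h3 i hi hiK
      omega
    rw [chainTerm, chainTerm, h5, pow_add]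
    ring
  have hzero : ∑ N ∈ chains K m with ¬ N (i + 1) < N i,
      chainTerm K q v N * (1 - q ^ (2 * (N i - N (i + 1)))) = 0 := sum_eq_zero fun N hN => by
    rw [mem_filter, not_lt] at hN
    simp [Nat.sub_eq_zero_of_le hN.2]
  rw [sum_congr rfl hterm, ← sum_filter_add_sum_filter_not _ fun N => N (i + 1) < N i, hzero,
    add_zero]
  split_ifs with him
  · rw [coeff_mk, mul_sum]
    symm
    refine sum_bij (fun M _ n => M n + initSeg i n) (fun M hM => ?_) (fun M _ M' _ hMM' => ?_)
      (fun N hN => ?_) (fun M hM => ?_)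
    · rw [mem_filter]
      have h1 := add_initSeg_mem_chains hiK hM
      rw [Nat.sub_add_cancel him] at h1
      have h2 := (mem_chains.1 hM).2 i hi hiK
      refine ⟨h1, ?_⟩
      simp only [initSeg]
      split_ifs <;> omega
    · exact funext fun n => Nat.add_right_cancel (congrFun hMM' n)
    · rw [mem_filter] at hN
      obtain ⟨-, M, hM, hNM⟩ := exists_eq_add_initSeg hi hiK hN.1 hN.2
      exact ⟨M, hM, hNM.symm⟩
    · rw [← hc', ← chainTerm_add_initSeg hq hi hiK hM]
      have h2 := (mem_chains.1 hM).2 i hi hiK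
      congr 4
      simp only [initSeg]
      split_ifs <;> omega
  · rw [mul_zero]
    refine sum_eq_zero fun N hN => absurd ?_ him
    rw [mem_filter] at hN
    exact (exists_eq_add_initSeg hi hiK hN.1 hN.2).1

lemma rescale_multisum (K : ℕ) (q : ℂ) (v : ℕ → ℕ) :
    rescale (q ^ 2) (multisum K q v) = multisum K q fun n => v n + initSeg K n := by
  have h0 : v 0 + initSeg K 0 = v 0 := by simp [initSeg]
  simp only [multisum, h0]
  split_ifs
  · ext m
    rw [coeff_rescale, coeff_mk, coeff_mk, mul_sum]
    refine sum_congr rfl fun N hN => ?_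
    have h1 : chainExp K (fun n => v n + initSeg K n) N = 2 * m + chainExp K v N := by
      rw [← (mem_chains.1 hN).1.1, ← sum_initSeg_mul le_rfl, chainExp, chainExp, mul_sum,
        ← sum_add_distrib]
      exact sum_congr rfl fun n _ => by ring
    rw [chainTerm, chainTerm, h1, pow_add, pow_mul]
    ring
  · simp

/-- The indicator function of `{b + 2l + ε_l : l ≥ 0}`, where `ε_l` is `1` for `lo ≤ l < hi` and
`0` otherwise. -/
def mark (b lo hi n : ℕ) : ℕ :=
  if n < b then 0
  else if (n - b) % 2 = 1 then (if lo ≤ (n - b) / 2 ∧ (n - b) / 2 < hi then 1 else 0)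
  else (if lo ≤ (n - b) / 2 ∧ (n - b) / 2 < hi then 0 else 1)

/-- The indicator function of `{a, a + 2, a + 4, …}`. -/
def ladder (a n : ℕ) : ℕ := if a ≤ n ∧ n % 2 = a % 2 then 1 else 0

lemma sum_range_mark (b lo hi l : ℕ) : ∑ n ∈ range (b + 2 * l), mark b lo hi n = l := by
  induction l with
  | zero => exact sum_eq_zero fun n hn => if_pos (by simpa using hn)
  | succ l ih =>
    rw [show b + 2 * (l + 1) = b + 2 * l + 1 + 1 by ring, sum_range_succ, sum_range_succ, ih]
    unfold mark
    split_ifs <;> omega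

lemma sum_range_succ_mark {b lo hi l : ℕ} (h1 : lo ≤ l) (h2 : l < hi) :
    ∑ n ∈ range (b + 2 * l + 1), mark b lo hi n = l := by
  rw [sum_range_succ, sum_range_mark, mark, if_neg (by omega), if_neg (by omega),
    if_pos (by omega), add_zero]

lemma sum_range_initSeg (p i : ℕ) : ∑ n ∈ range (i + 1), initSeg p n = min p i := by
  induction i with
  | zero => simp [initSeg]
  | succ i ih =>
    rw [sum_range_succ, ih, initSeg]
    split_ifs <;> omega

lemma mark_sub_top {b lo l : ℕ} (h : lo ≤ l) (n : ℕ) :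
    mark b lo l n + (if n = b + 2 * l + 1 then 1 else 0) =
      mark b lo (l + 1) n + (if n = b + 2 * l then 1 else 0) := by
  unfold mark
  split_ifs <;> omega

lemma mark_sub_bot {b l hi : ℕ} (h : l < hi) (n : ℕ) :
    mark b (l + 1) hi n + (if n = b + 2 * l + 1 then 1 else 0) =
      mark b l hi n + (if n = b + 2 * l then 1 else 0) := by
  unfold mark
  split_ifs <;> omega

section

variable {K b m : ℕ} {q : ℂ}

lemma multisum_ladder_succ (hq : ‖q‖ < 1) (hm : b + 2 * m ≤ K) (hm' : K ≤ b + 2 * m + 1) :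
    multisum K q (ladder (b + 1)) = multisum K q (ladder b) + C q ^ b * X ^ b *
      ∑ j ∈ range (m + 1), (C q ^ 4 * X ^ 2) ^ j *
        multisum K q fun n => initSeg (b + 2 * j) n + mark b j (m + 1) n := by
  have key : ∀ s ≤ m + 1, multisum K q (mark b 0 (m + 1)) = multisum K q (mark b s (m + 1)) +
      C q ^ b * X ^ b * ∑ j ∈ range s, (C q ^ 4 * X ^ 2) ^ j *
        multisum K q fun n => initSeg (b + 2 * j) n + mark b j (m + 1) n := by
    intro s hs
    induction s with
    | zero => simp
    | succ s ih =>
      rw [ih (by omega), sum_range_succ, multisum_step hq (by omega : b + 2 * s ≤ K)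
        (mark_sub_bot (by omega)) (fun n => add_comm _ _)
        (sum_range_succ_mark le_rfl (by omega))]
      ring
  rw [multisum_congr (v := ladder (b + 1)) (v' := mark b 0 (m + 1)),
    multisum_congr (v := ladder b) (v' := mark b (m + 1) (m + 1)), key _ le_rfl]
  all_goals
    intro n hn
    unfold ladder mark
    split_ifs <;> omega

lemma multisum_initSeg_add_mark_top (hq : ‖q‖ < 1) {j h : ℕ} (hj : j + 1 ≤ h)
    (hh : b + 2 * h ≤ K + 2) :
    multisum K q (fun n => initSeg (b + 2 * j) n + mark b j h n) =
      multisum K q (fun n => initSeg (b + 2 * j) n + mark b j (j + 1) n) +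
      ∑ l ∈ Ico (j + 1) h, C q ^ (b + 2 * l + 2 * (b + 2 * j + l)) * X ^ (b + 2 * l) *
        multisum K q fun n => initSeg (b + 2 * j) n + mark b j (l + 1) n + initSeg (b + 2 * l) n := by
  induction h, hj using Nat.le_induction with
  | base => simp
  | succ l hl ih =>
    rw [sum_Ico_succ_top hl, ← add_assoc, ← ih (by omega)]
    refine multisum_step hq (by omega) (fun n => ?_) (fun n => rfl) ?_
    · rw [add_assoc, mark_sub_top (by omega), add_assoc]
    · rw [sum_add_distrib, sum_range_initSeg, sum_range_succ_mark (by omega) (by omega),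
        min_eq_left (by omega)]

lemma multisum_initSeg_add_mark_bot (hq : ‖q‖ < 1) {j : ℕ} (hj : b + 2 * j ≤ K) :
    multisum K q (fun n => initSeg (b + 2 * j) n + mark b 0 (j + 1) n) =
      multisum K q (fun n => initSeg (b + 2 * j) n + mark b j (j + 1) n) +
      ∑ l ∈ range j, C q ^ (b + 2 * l + 2 * (b + 2 * l + l)) * X ^ (b + 2 * l) *
        multisum K q fun n => initSeg (b + 2 * j) n + mark b l (j + 1) n + initSeg (b + 2 * l) n := by
  have key : ∀ s ≤ j, multisum K q (fun n => initSeg (b + 2 * j) n + mark b 0 (j + 1) n) =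
      multisum K q (fun n => initSeg (b + 2 * j) n + mark b s (j + 1) n) +
      ∑ l ∈ range s, C q ^ (b + 2 * l + 2 * (b + 2 * l + l)) * X ^ (b + 2 * l) *
        multisum K q fun n =>
          initSeg (b + 2 * j) n + mark b l (j + 1) n + initSeg (b + 2 * l) n := by
    intro s hs
    induction s with
    | zero => simp
    | succ s ih =>
      rw [ih (by omega), sum_range_succ, add_comm (∑ l ∈ range s, _), ← add_assoc]
      congr 1
      refine multisum_step hq (by omega) (fun n => ?_) (fun n => rfl) ?_
      · rw [add_assoc, mark_sub_bot (by omega), add_assoc]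
      · rw [sum_add_distrib, sum_range_initSeg, sum_range_succ_mark (by omega) (by omega),
          min_eq_right (by omega)]
  exact key j le_rfl

lemma sum_multisum_initSeg_add_mark (hq : ‖q‖ < 1) (hm : b + 2 * m ≤ K) :
    ∑ j ∈ range (m + 1), (C q ^ 4 * X ^ 2) ^ j *
        multisum K q (fun n => initSeg (b + 2 * j) n + mark b j (m + 1) n) =
      ∑ j ∈ range (m + 1), (C q ^ 4 * X ^ 2) ^ j *
        multisum K q fun n => initSeg (b + 2 * j) n + mark b 0 (j + 1) n := by
  rw [sum_congr rfl fun j hj => by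
      rw [multisum_initSeg_add_mark_top hq (by simpa using hj) (by omega), mul_add],
    sum_add_distrib]
  conv_rhs =>
    rw [sum_congr rfl fun j hj => by
      rw [multisum_initSeg_add_mark_bot hq (by have := mem_range.1 hj; omega), mul_add],
      sum_add_distrib]
  congr 1
  simp only [mul_sum]
  rw [sum_comm' (t' := range (m + 1)) (s' := fun l => range l)
    (fun j l => by simp only [mem_range, mem_Ico]; omega)]
  refine sum_congr rfl fun l _ => sum_congr rfl fun j _ => ?_
  rw [show (fun n => initSeg (b + 2 * l) n + mark b j (l + 1) n + initSeg (b + 2 * j) n) =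
    fun n => initSeg (b + 2 * j) n + mark b j (l + 1) n + initSeg (b + 2 * l) n from
      funext fun n => by ring]
  ring

lemma sum_multisum_eq_sum_rescale (hq : ‖q‖ < 1) {d : ℕ} (hd : b + d = K) :
    ∑ j ∈ range (d / 2 + 1), (C q ^ 4 * X ^ 2) ^ j *
        multisum K q (fun n => initSeg (b + 2 * j) n + mark b j (d / 2 + 1) n) =
      ∑ c ∈ Icc b K with c % 2 = K % 2, (C q ^ 2 * X) ^ (K - c) *
        rescale (q ^ 2) (multisum K q (ladder (c + 1))) := by
  induction d generalizing b with
  | zero =>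
    obtain rfl : b = K := by omega
    rw [sum_multisum_initSeg_add_mark hq (by omega)]
    simp only [Nat.zero_div, zero_add, range_one, sum_singleton, pow_zero, one_mul, Icc_self,
      filter_true_of_mem (s := {b}) (p := fun c => c % 2 = b % 2) (by simp), Nat.sub_self,
      rescale_multisum]
    refine multisum_congr fun n hn => ?_
    unfold ladder mark initSeg
    split_ifs <;> omega
  | succ d ih =>
    rw [sum_multisum_initSeg_add_mark hq (by omega), ← insert_Icc_add_one_left_eq_Icc (by omega : b ≤ K),
      filter_insert]
    have hcongr : ∀ j ∈ range (d / 2 + 1), (C q ^ 4 * X ^ 2) ^ j *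
        multisum K q (fun n => initSeg (b + 2 * j) n + mark b 0 (j + 1) n) =
        (C q ^ 4 * X ^ 2) ^ j *
        multisum K q (fun n => initSeg (b + 1 + 2 * j) n + mark (b + 1) j (d / 2 + 1) n) := by
      intro j hj
      rw [mem_range] at hj
      congr 1
      refine multisum_congr fun n hn => ?_
      unfold mark initSeg
      split_ifs <;> omega
    split_ifs with hpar
    · rw [show (d + 1) / 2 = d / 2 + 1 by omega, sum_range_succ, sum_congr rfl hcongr,
        ih (by omega), sum_insert (by simp), add_comm, rescale_multisum]
      congr 1
      rw [show K - b = 2 * (d / 2 + 1) by omega, pow_mul,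
        show (C q ^ 2 * X) ^ 2 = (C q ^ 4 * X ^ 2 : PowerSeries ℂ) by ring]
      congr 1
      refine multisum_congr fun n hn => ?_
      unfold ladder mark initSeg
      split_ifs <;> omega
    · rw [show (d + 1) / 2 = d / 2 by omega, sum_congr rfl hcongr, ih (by omega)]

/-- The functional equations of the multisums. -/
lemma multisum_ladder_rec (hq : ‖q‖ < 1) (hb : b ≤ K) :
    multisum K q (ladder (b + 1)) = multisum K q (ladder b) + C q ^ b * X ^ b *
      ∑ c ∈ Icc b K with c % 2 = K % 2, (C q ^ 2 * X) ^ (K - c) *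
        rescale (q ^ 2) (multisum K q (ladder (c + 1))) := by
  rw [multisum_ladder_succ (m := (K - b) / 2) hq (by omega) (by omega),
    sum_multisum_eq_sum_rescale hq (by omega)]

end

/-- Admissible multiplicity sequences; `f i` is the multiplicity of the part `i + 1`. -/
def Admissible (K a : ℕ) (f : ℕ →₀ ℕ) : Prop :=
  f 0 < a ∧ (∀ i, f i + f (i + 1) ≤ K) ∧ ∀ j, Even (f (2 * j + 1))

/-- The number of parts. -/
def numParts (f : ℕ →₀ ℕ) : ℕ := f.sum fun _ n => n

/-- The sum of the parts. -/
def size (f : ℕ →₀ ℕ) : ℕ := f.sum fun i n => n * (i + 1)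

lemma summable_pow_size (K : ℕ) {r : ℝ} (hr0 : 0 ≤ r) (hr : r < 1) :
    Summable fun f : {f : ℕ →₀ ℕ // ∀ i, f i ≤ K} => r ^ size f.1 := by
  refine summable_of_sum_le (c := Real.exp (K * (1 - r)⁻¹)) (fun f => pow_nonneg hr0 _)
    fun s => ?_
  obtain ⟨M, hM⟩ : ∃ M, ∀ f ∈ s, f.1.support ⊆ range M := by
    obtain ⟨M, hM⟩ := (s.biUnion fun f => f.1.support).exists_nat_subset_range
    exact ⟨M, fun f hf => (subset_biUnion_of_mem (fun f => f.1.support) hf).trans hM⟩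
  have hsize : ∀ f ∈ s, r ^ size f.1 = ∏ i : Fin M, r ^ (f.1 i * ((i : ℕ) + 1)) := fun f hf => by
    rw [size, Finsupp.sum_of_support_subset _ (hM f hf) _ (by simp), ← prod_pow_eq_pow_sum,
      prod_range]
  calc ∑ f ∈ s, r ^ size f.1
      = ∑ f ∈ s, ∏ i : Fin M, r ^ (f.1 i * ((i : ℕ) + 1)) := sum_congr rfl hsize
    _ = ∑ p ∈ s.image (fun f (i : Fin M) => f.1 i), ∏ i : Fin M, r ^ (p i * ((i : ℕ) + 1)) := by
        rw [sum_image]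
        intro f hf g hg hfg
        refine Subtype.ext (Finsupp.ext fun i => ?_)
        by_cases hi : i < M
        · exact congrFun hfg ⟨i, hi⟩
        · have h1 : i ∉ f.1.support := fun h => hi (mem_range.1 (hM f hf h))
          have h2 : i ∉ g.1.support := fun h => hi (mem_range.1 (hM g hg h))
          rw [Finsupp.notMem_support_iff.1 h1, Finsupp.notMem_support_iff.1 h2]
    _ ≤ ∑ p ∈ Fintype.piFinset fun _ : Fin M => range (K + 1),
          ∏ i : Fin M, r ^ (p i * ((i : ℕ) + 1)) := by
        refine sum_le_sum_of_subset_of_nonneg (fun p hp => ?_)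
          fun p _ _ => prod_nonneg fun i _ => pow_nonneg hr0 _
        obtain ⟨f, -, rfl⟩ := mem_image.1 hp
        exact Fintype.mem_piFinset.2 fun i => mem_range.2 (Nat.lt_succ_of_le (f.2 i))
    _ = ∏ i : Fin M, ∑ n ∈ range (K + 1), r ^ (n * ((i : ℕ) + 1)) :=
        (prod_univ_sum (fun _ : Fin M => range (K + 1))
          fun i n => r ^ (n * ((i : ℕ) + 1))).symm
    _ ≤ ∏ i : Fin M, Real.exp (K * r ^ (i : ℕ)) := by
        refine prod_le_prod (fun i _ => sum_nonneg fun n _ => pow_nonneg hr0 _) fun i _ => ?_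
        rw [sum_range_succ', zero_mul, pow_zero]
        refine le_trans ?_ (Real.add_one_le_exp _)
        gcongr
        calc ∑ n ∈ range K, r ^ ((n + 1) * ((i : ℕ) + 1)) ≤ ∑ n ∈ range K, r ^ (i : ℕ) :=
              sum_le_sum fun n _ => pow_le_pow_of_le_one hr0 hr.le (by nlinarith)
          _ = K * r ^ (i : ℕ) := by simp
    _ = Real.exp (K * ∑ i ∈ range M, r ^ i) := by
        rw [← Real.exp_sum, mul_sum, sum_range]
    _ ≤ Real.exp (K * (1 - r)⁻¹) := by
        rw [← tsum_geometric_of_lt_one hr0 hr]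
        gcongr
        exact (summable_geometric_of_lt_one hr0 hr).sum_le_tsum _ fun i _ => pow_nonneg hr0 _

lemma summable_ite_pow_size {K : ℕ} {q : ℂ} (hq : ‖q‖ < 1) {p : (ℕ →₀ ℕ) → Prop}
    [DecidablePred p]
    (hp : ∀ f, p f → ∀ i, f i ≤ K) : Summable fun f => if p f then q ^ size f else 0 := by
  have h : Summable ({f : ℕ →₀ ℕ | ∀ i, f i ≤ K}.indicator fun f => ‖q‖ ^ size f) :=
    summable_subtype_iff_indicator.1 (summable_pow_size K (norm_nonneg q) hq)
  refine h.of_norm_bounded fun f => ?_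
  split_ifs with hf
  · rw [Set.indicator_of_mem (show f ∈ {f : ℕ →₀ ℕ | ∀ i, f i ≤ K} from hp f hf), norm_pow]
  · rw [norm_zero]
    exact Set.indicator_nonneg (fun f _ => pow_nonneg (norm_nonneg q) _) f

lemma Admissible.le {K a : ℕ} {f : ℕ →₀ ℕ} (h : Admissible K a f) (i : ℕ) : f i ≤ K :=
  (Nat.le_add_right _ _).trans (h.2.1 i)

open Classical in
/-- The generating function of the admissible sequences, graded by the number of parts. -/
noncomputable def partGF (K : ℕ) (q : ℂ) (a : ℕ) : PowerSeries ℂ :=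
  mk fun m => ∑' f, if Admissible K a f ∧ numParts f = m then q ^ size f else 0

/-- Prepend two multiplicities. -/
noncomputable def cons₂ (b i : ℕ) (g : ℕ →₀ ℕ) : ℕ →₀ ℕ :=
  Finsupp.single 0 b + Finsupp.single 1 i + g.embDomain (addRightEmbedding 2)

lemma cons₂_zero (b i : ℕ) (g : ℕ →₀ ℕ) : cons₂ b i g 0 = b := by
  have : (g.embDomain (addRightEmbedding 2)) 0 = 0 :=
    Finsupp.embDomain_of_notMem_range _ _ _ (by simp)
  simp [cons₂, this]

lemma cons₂_one (b i : ℕ) (g : ℕ →₀ ℕ) : cons₂ b i g 1 = i := by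
  have : (g.embDomain (addRightEmbedding 2)) 1 = 0 :=
    Finsupp.embDomain_of_notMem_range _ _ _ (by simp)
  simp [cons₂, this]

lemma cons₂_add_two (b i : ℕ) (g : ℕ →₀ ℕ) (n : ℕ) : cons₂ b i g (n + 2) = g n := by
  have : (g.embDomain (addRightEmbedding 2)) (n + 2) = g n :=
    Finsupp.embDomain_apply_self (addRightEmbedding 2) g n
  simp [cons₂, this]

lemma numParts_cons₂ (b i : ℕ) (g : ℕ →₀ ℕ) : numParts (cons₂ b i g) = numParts g + b + i := by
  rw [numParts, cons₂, Finsupp.sum_add_index' (by simp) (by simp),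
    Finsupp.sum_add_index' (by simp) (by simp), Finsupp.sum_embDomain,
    Finsupp.sum_single_index rfl, Finsupp.sum_single_index rfl, ← numParts]
  ring

lemma size_cons₂ (b i : ℕ) (g : ℕ →₀ ℕ) :
    size (cons₂ b i g) = size g + 2 * numParts g + b + 2 * i := by
  rw [size, cons₂, Finsupp.sum_add_index' (by simp) (by intros; ring),
    Finsupp.sum_add_index' (by simp) (by intros; ring), Finsupp.sum_embDomain,
    Finsupp.sum_single_index (by simp), Finsupp.sum_single_index (by simp), numParts, size,
    Finsupp.mul_sum, ← Finsupp.sum_add]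
  have : (g.sum fun a n => n * (addRightEmbedding 2 a + 1)) =
      g.sum fun a n => n * (a + 1) + 2 * n :=
    Finsupp.sum_congr fun a _ => by rw [addRightEmbedding_apply]; ring
  rw [this]
  ring

lemma cons₂_injective (b i : ℕ) : Function.Injective (cons₂ b i) := fun g g' h =>
  Finsupp.ext fun n => by rw [← cons₂_add_two b i g, h, cons₂_add_two]

lemma exists_eq_cons₂ (f : ℕ →₀ ℕ) : ∃ g, f = cons₂ (f 0) (f 1) g := by
  refine ⟨f.comapDomain (· + 2) (add_left_injective 2).injOn, Finsupp.ext fun n => ?_⟩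
  match n with
  | 0 => rw [cons₂_zero]
  | 1 => rw [cons₂_one]
  | n + 2 => rw [cons₂_add_two, Finsupp.comapDomain_apply]

lemma admissible_cons₂ {K b c : ℕ} (hbc : b ≤ c) (hc : c ≤ K) (hpar : c % 2 = K % 2)
    (g : ℕ →₀ ℕ) : Admissible K (b + 1) (cons₂ b (K - c) g) ↔ Admissible K (c + 1) g := by
  constructor
  · rintro ⟨-, h2, h3⟩
    refine ⟨?_, fun i => ?_, fun j => ?_⟩
    · have := h2 1
      rw [cons₂_one, cons₂_add_two] at this
      omega
    · have := h2 (i + 2)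
      rwa [show i + 2 + 1 = i + 1 + 2 by ring, cons₂_add_two, cons₂_add_two] at this
    · have := h3 (j + 1)
      rwa [show 2 * (j + 1) + 1 = 2 * j + 1 + 2 by ring, cons₂_add_two] at this
  · rintro ⟨h1, h2, h3⟩
    refine ⟨by rw [cons₂_zero]; omega, fun i => ?_, fun j => ?_⟩
    · match i with
      | 0 => rw [cons₂_zero, cons₂_one]; omega
      | 1 => rw [cons₂_one, cons₂_add_two]; omega
      | i + 2 =>
        rw [show i + 2 + 1 = i + 1 + 2 by ring, cons₂_add_two, cons₂_add_two]
        exact h2 i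
    · match j with
      | 0 => rw [mul_zero, zero_add, cons₂_one, Nat.even_iff]; omega
      | j + 1 =>
        rw [show 2 * (j + 1) + 1 = 2 * j + 1 + 2 by ring, cons₂_add_two]
        exact h3 j

open Classical in
lemma tsum_admissible_cons₂ {K b c : ℕ} (hbc : b ≤ c) (hc : c ≤ K) (hpar : c % 2 = K % 2)
    (q : ℂ) (m : ℕ) :
    ∑' f : ℕ →₀ ℕ, (if Admissible K (b + 1) f ∧ f 0 = b ∧ f 1 = K - c ∧ numParts f = m
        then q ^ size f else 0) =
      coeff m (C q ^ b * X ^ b * ((C q ^ 2 * X) ^ (K - c) *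
        rescale (q ^ 2) (partGF K q (c + 1)))) := by
  rw [show C q ^ b * X ^ b * ((C q ^ 2 * X) ^ (K - c) * rescale (q ^ 2) (partGF K q (c + 1))) =
      C (q ^ (b + 2 * (K - c))) * (X ^ (b + (K - c)) * rescale (q ^ 2) (partGF K q (c + 1))) by
    rw [map_pow]; ring, coeff_C_mul, coeff_X_pow_mul']
  rw [← (cons₂_injective b (K - c)).tsum_eq]
  · simp only [cons₂_zero, cons₂_one, admissible_cons₂ hbc hc hpar, numParts_cons₂, size_cons₂,
      true_and]
    split_ifs with h
    · rw [coeff_rescale, partGF, coeff_mk, ← tsum_mul_left, ← tsum_mul_left]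
      refine tsum_congr fun g => ?_
      have h1 : numParts g + b + (K - c) = m ↔ numParts g = m - (b + (K - c)) := by omega
      simp only [h1]
      split_ifs with h2
      · rw [← h2.2]; ring
      · simp
    · rw [mul_zero]
      refine (tsum_congr fun g => if_neg ?_).trans tsum_zero
      omega
  · intro f hf
    rw [Function.mem_support, ne_eq, ite_eq_right_iff, Classical.not_imp] at hf
    obtain ⟨g, hg⟩ := exists_eq_cons₂ f
    rw [hf.1.2.1, hf.1.2.2.1] at hg
    exact ⟨g, hg.symm⟩

/-- The functional equations of the generating functions of admissible sequences. -/
lemma partGF_rec {K b : ℕ} {q : ℂ} (hq : ‖q‖ < 1) :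
    partGF K q (b + 1) = partGF K q b + C q ^ b * X ^ b *
      ∑ c ∈ Icc b K with c % 2 = K % 2, (C q ^ 2 * X) ^ (K - c) *
        rescale (q ^ 2) (partGF K q (c + 1)) := by
  classical
  ext m
  rw [mul_sum, map_add, map_sum, ← sum_congr rfl fun c hc => tsum_admissible_cons₂
    (mem_Icc.1 (mem_filter.1 hc).1).1 (mem_Icc.1 (mem_filter.1 hc).1).2 (mem_filter.1 hc).2 q m,
    ← Summable.tsum_finsetSum, partGF, partGF, coeff_mk, coeff_mk, ← Summable.tsum_add]
  · refine tsum_congr fun f => ?_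
    by_cases h : Admissible K (b + 1) f ∧ numParts f = m
    · rw [if_pos h]
      have h1 := h.1.1
      have h2 : f 0 + f 1 ≤ K := h.1.2.1 0
      have h3 : Even (f 1) := h.1.2.2 0
      rw [Nat.even_iff] at h3
      by_cases h0 : f 0 = b
      · have hb : ¬ Admissible K b f := fun h' => by have := h'.1; omega
        rw [if_neg (by tauto), zero_add, sum_eq_single (K - f 1), if_pos]
        · exact ⟨h.1, h0, by omega, h.2⟩
        · intro c hc hne
          rw [mem_filter, mem_Icc] at hc
          exact if_neg (by omega)
        · intro hc
          rw [mem_filter, mem_Icc] at hc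
          omega
      · have hb : Admissible K b f := ⟨by omega, h.1.2⟩
        rw [if_pos ⟨hb, h.2⟩, sum_eq_zero fun c _ => if_neg (by tauto), add_zero]
    · have hb : ¬ (Admissible K b f ∧ numParts f = m) := fun h' =>
        h ⟨⟨h'.1.1.trans (Nat.lt_succ_self b), h'.1.2⟩, h'.2⟩
      rw [if_neg h, if_neg hb, sum_eq_zero fun c _ => if_neg (by tauto), add_zero]
  · exact summable_ite_pow_size hq fun f hf => hf.1.le
  · exact summable_sum fun c _ => summable_ite_pow_size hq fun f hf => hf.1.le
  · exact fun c _ => summable_ite_pow_size hq fun f hf => hf.1.le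

lemma partGF_zero (K : ℕ) (q : ℂ) : partGF K q 0 = 0 := by
  ext m
  simp [partGF, Admissible]

lemma coeff_zero_partGF {K a : ℕ} (ha : 1 ≤ a) (q : ℂ) : coeff 0 (partGF K q a) = 1 := by
  rw [partGF, coeff_mk, tsum_eq_single 0]
  · rw [if_pos ⟨⟨ha, by simp, by simp⟩, by simp [numParts]⟩]
    simp [size]
  · intro f hf
    refine if_neg fun h => hf (Finsupp.ext fun i => ?_)
    by_contra hi
    exact hi (sum_eq_zero_iff.1 h.2 i (Finsupp.mem_support_iff.2 hi))

lemma coeff_zero_multisum {K : ℕ} (q : ℂ) {v : ℕ → ℕ} (hv : v 0 = 0) :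
    coeff 0 (multisum K q v) = 1 := by
  have : chains K 0 = {0} := by
    ext N
    rw [mem_chains, mem_singleton]
    constructor
    · rintro ⟨⟨h1, h2⟩, -⟩
      funext i
      by_contra hi
      exact hi (sum_eq_zero_iff.1 h1 i (mem_Icc.2 (h2 i hi)))
    · rintro rfl
      simp
  rw [multisum, if_pos hv, coeff_mk, this, sum_singleton]
  simp [chainTerm, chainExp, sqPoch]

/-- The functional equations have at most one solution with given constant coefficients. -/
lemma eq_zero_of_rec {K : ℕ} {q : ℂ} (hq : ‖q‖ < 1) {D : ℕ → PowerSeries ℂ} (hD0 : D 0 = 0)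
    (hconst : ∀ b ≤ K, coeff 0 (D (b + 1)) = 0)
    (hrec : ∀ b ≤ K, D (b + 1) = D b + C q ^ b * X ^ b *
      ∑ c ∈ Icc b K with c % 2 = K % 2, (C q ^ 2 * X) ^ (K - c) * rescale (q ^ 2) (D (c + 1)))
    {b : ℕ} (hb : b ≤ K + 1) : D b = 0 := by
  have hcoeff : ∀ b ≤ K, ∀ m, coeff m (D (b + 1)) = coeff m (D b) +
      ∑ c ∈ Icc b K with c % 2 = K % 2, q ^ (b + 2 * (K - c)) * if b + (K - c) ≤ m then
        (q ^ 2) ^ (m - (b + (K - c))) * coeff (m - (b + (K - c))) (D (c + 1)) else 0 := by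
    intro b hb m
    rw [hrec b hb, map_add, mul_sum, map_sum]
    congr 1
    refine sum_congr rfl fun c _ => ?_
    rw [show C q ^ b * X ^ b * ((C q ^ 2 * X) ^ (K - c) * rescale (q ^ 2) (D (c + 1))) =
      C (q ^ (b + 2 * (K - c))) * (X ^ (b + (K - c)) * rescale (q ^ 2) (D (c + 1))) by
      rw [map_pow]; ring, coeff_C_mul, coeff_X_pow_mul', coeff_rescale]
  suffices h : ∀ m, ∀ b ≤ K, coeff m (D (b + 1)) = 0 by
    match b with
    | 0 => exact hD0
    | b + 1 => exact PowerSeries.ext fun m => by rw [h m b (by omega), map_zero]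
  intro m
  induction m using Nat.strong_induction_on with
  | _ m ih =>
    rcases Nat.eq_zero_or_pos m with rfl | hm
    · exact hconst
    have hsmall : ∀ b c, c ≤ K → 0 < b + (K - c) → (q ^ (b + 2 * (K - c)) *
        if b + (K - c) ≤ m then
          (q ^ 2) ^ (m - (b + (K - c))) * coeff (m - (b + (K - c))) (D (c + 1)) else 0) = 0 := by
      intro b c hc hpos
      split_ifs with h
      · rw [ih _ (by omega) c hc, mul_zero, mul_zero]
      · rw [mul_zero]
    have hfirst : ∀ b ≤ K, coeff m (D (b + 1)) = (q ^ 2) ^ m * coeff m (D (K + 1)) := by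
      intro b hb
      induction b with
      | zero =>
        rw [hcoeff 0 hb, hD0, map_zero, zero_add, sum_eq_single K]
        · simp
        · intro c hc hne
          rw [mem_filter, mem_Icc] at hc
          exact hsmall 0 c hc.1.2 (by omega)
        · intro h
          simp at h
      | succ b ihb =>
        rw [hcoeff (b + 1) hb, ihb (by omega), sum_eq_zero, add_zero]
        intro c hc
        rw [mem_filter, mem_Icc] at hc
        exact hsmall (b + 1) c hc.1.2 (by omega)
    have hK : coeff m (D (K + 1)) = 0 := by
      have h1 : (1 - q ^ (2 * m)) * coeff m (D (K + 1)) = 0 := by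
        rw [pow_mul, sub_mul, one_mul, ← hfirst K le_rfl, sub_self]
      exact (mul_eq_zero.1 h1).resolve_left (one_sub_pow_ne_zero hq (by omega))
    intro b hb
    rw [hfirst b hb, hK, mul_zero]

/-- The generating function by number of parts agrees with the multisum. -/
theorem partGF_eq_multisum {K a : ℕ} {q : ℂ} (hq : ‖q‖ < 1) (ha : a ≤ K + 1) :
    partGF K q a = multisum K q (ladder a) := by
  refine sub_eq_zero.1 (eq_zero_of_rec (D := fun a => partGF K q a - multisum K q (ladder a)) hq
    ?_ (fun b _ => ?_) (fun b hb => ?_) ha)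
  · simp [partGF_zero, multisum, ladder]
  · rw [map_sub, coeff_zero_partGF (by omega), coeff_zero_multisum q (by simp [ladder]), sub_self]
  · simp only [map_sub, mul_sub, sum_sub_distrib]
    rw [partGF_rec hq, multisum_ladder_rec hq hb]
    ring

/-- The sequence on `ℕ` listing `N_1, …, N_K` at the positions `1, …, K`. -/
def chainOf (K : ℕ) (N : Fin K → ℕ) (i : ℕ) : ℕ := if 1 ≤ i then _root_.ext K N i else 0

lemma chainOf_succ {K : ℕ} (N : Fin K → ℕ) (i : Fin K) : chainOf K N (i + 1) = N i := by
  simp [chainOf, _root_.ext]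

lemma chainOf_eq_zero {K : ℕ} (N : Fin K → ℕ) {i : ℕ} (hi : ¬ (1 ≤ i ∧ i ≤ K)) :
    chainOf K N i = 0 := by
  unfold chainOf _root_.ext
  split_ifs <;> first | rfl | omega

lemma sum_chainOf {K : ℕ} (N : Fin K → ℕ) : ∑ i ∈ Icc 1 K, chainOf K N i = ∑ i, N i := by
  rw [← sum_congr rfl fun i _ => chainOf_succ N i, ← sum_range fun i => chainOf K N (i + 1),
    range_eq_Ico, sum_Ico_add' (chainOf K N) 0 K 1]
  rfl

lemma chainOf_mem_chains {K : ℕ} {N : Fin K → ℕ} (hN : Antitone N) :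
    chainOf K N ∈ chains K (∑ i, N i) := by
  refine mem_chains.2 ⟨⟨sum_chainOf N, fun i hi => ?_⟩, fun i hi hiK => ?_⟩
  · by_contra h
    exact hi (chainOf_eq_zero N h)
  · by_cases h : i + 1 ≤ K
    · obtain ⟨j, rfl⟩ := Nat.exists_eq_add_of_le' hi
      exact (chainOf_succ N ⟨j + 1, h⟩).trans_le
        ((hN (show (⟨j, by omega⟩ : Fin K) ≤ ⟨j + 1, h⟩ from Nat.le_succ j)).trans
          (chainOf_succ N ⟨j, by omega⟩).ge)
    · rw [chainOf_eq_zero N (by omega)]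
      exact Nat.zero_le _

/-- Antitone tuples with sum `m` correspond to `chains K m`. -/
noncomputable def fiberEquivChains (K m : ℕ) :
    (fun N : {N : Fin K → ℕ // Antitone N} => ∑ i, N.1 i) ⁻¹' {m} ≃ chains K m :=
  Equiv.ofBijective
    (fun N => ⟨chainOf K N.1.1, by
      have h := chainOf_mem_chains N.1.2
      rwa [show ∑ i, N.1.1 i = m from N.2] at h⟩) <| by
    constructor
    · intro N N' h
      refine Subtype.ext (Subtype.ext (funext fun i => ?_))
      have h1 : chainOf K N.1.1 = chainOf K N'.1.1 := congrArg Subtype.val h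
      rw [← chainOf_succ N.1.1, h1, chainOf_succ]
    · rintro ⟨M, hM⟩
      have hMN : chainOf K (fun i : Fin K => M (i + 1)) = M := funext fun n => by
        by_cases hn : 1 ≤ n ∧ n ≤ K
        · obtain ⟨j, rfl⟩ := Nat.exists_eq_add_of_le' hn.1
          exact chainOf_succ (fun i : Fin K => M (i + 1)) ⟨j, by omega⟩
        · rw [chainOf_eq_zero _ hn]
          by_contra h
          exact hn ((mem_chains.1 hM).1.2 n (Ne.symm h))
      have hanti : Antitone fun i : Fin K => M (i + 1) := fun i j hij =>
        le_of_mem_chains hM (by omega) (Nat.succ_le_succ hij) (by omega)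
      refine ⟨⟨⟨_, hanti⟩, ?_⟩, Subtype.ext hMN⟩
      change ∑ i : Fin K, M (i + 1) = m
      rw [← sum_chainOf fun i : Fin K => M (i + 1), hMN]
      exact (mem_chains.1 hM).1.1

lemma hasSum_fiber {E : Type*} [AddCommMonoid E] [TopologicalSpace E] (K m : ℕ)
    (g : (ℕ → ℕ) → E) :
    HasSum (fun N : (fun N : {N : Fin K → ℕ // Antitone N} => ∑ i, N.1 i) ⁻¹' {m} =>
      g (chainOf K N.1.1)) (∑ N ∈ chains K m, g N) :=
  (fiberEquivChains K m).hasSum_iff.2 ((chains K m).hasSum g)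

lemma kurTerm_eq_chainTerm (k a : ℕ) (ha : 1 ≤ a) (q : ℂ) (N : Fin (k - 1) → ℕ) :
    kurTerm k a q N = chainTerm (k - 1) q (ladder a) (chainOf (k - 1) N) := by
  have hpos : ∀ i, 1 ≤ i → chainOf (k - 1) N i = _root_.ext (k - 1) N i := fun i hi => if_pos hi
  have hexp : chainExp (k - 1) (ladder a) (chainOf (k - 1) N) =
      (∑ i ∈ Icc 1 (k - 1), (_root_.ext (k - 1) N i) ^ 2) +
        ∑ i ∈ (Icc a (k - 1)).filter (fun i => i % 2 = a % 2), 2 * _root_.ext (k - 1) N i := by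
    rw [chainExp, sum_add_distrib]
    congr 1
    · exact sum_congr rfl fun i hi => by rw [hpos i (mem_Icc.1 hi).1]
    · rw [show (Icc a (k - 1)).filter (fun i => i % 2 = a % 2) =
        (Icc 1 (k - 1)).filter (fun i => a ≤ i ∧ i % 2 = a % 2) by
          ext i; simp only [mem_filter, mem_Icc]; omega, sum_filter]
      refine sum_congr rfl fun i hi => ?_
      rw [hpos i (mem_Icc.1 hi).1, ladder]
      split_ifs <;> simp
  rw [kurTerm, chainTerm, hexp]
  congr 1
  exact prod_congr rfl fun i hi => by
    rw [hpos i (mem_Icc.1 hi).1, hpos (i + 1) (by omega)]; rfl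

lemma sqPoch_pos {r : ℝ} (hr0 : 0 ≤ r) (hr : r < 1) (n : ℕ) : 0 < sqPoch r n := by
  refine prod_pos fun j _ => ?_
  rw [← pow_succ', ← pow_mul, sub_pos]
  exact pow_lt_one₀ hr0 hr (by omega)

lemma sqPoch_norm_le {q : ℂ} (hq : ‖q‖ < 1) (n : ℕ) : sqPoch ‖q‖ n ≤ ‖sqPoch q n‖ := by
  rw [sqPoch, sqPoch, norm_prod]
  refine prod_le_prod (fun j _ => ?_) fun j _ => ?_
  · rw [← pow_succ', ← pow_mul, sub_nonneg]
    exact pow_le_one₀ (norm_nonneg q) hq.le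
  · calc 1 - ‖q‖ ^ 2 * (‖q‖ ^ 2) ^ j = ‖(1 : ℂ)‖ - ‖q ^ 2 * (q ^ 2) ^ j‖ := by simp
      _ ≤ _ := norm_sub_norm_le _ _

lemma chainTerm_nonneg (K : ℕ) {r : ℝ} (hr0 : 0 ≤ r) (hr : r < 1) (v N : ℕ → ℕ) :
    0 ≤ chainTerm K r v N :=
  div_nonneg (pow_nonneg hr0 _) (prod_nonneg fun _ _ => (sqPoch_pos hr0 hr _).le)

lemma norm_chainTerm_le (K : ℕ) {q : ℂ} (hq : ‖q‖ < 1) (v N : ℕ → ℕ) :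
    ‖chainTerm K q v N‖ ≤ chainTerm K ‖q‖ v N := by
  rw [chainTerm, chainTerm, norm_div, norm_pow, norm_prod]
  refine div_le_div_of_nonneg_left (pow_nonneg (norm_nonneg q) _)
    (prod_pos fun _ _ => sqPoch_pos (norm_nonneg q) hq _)
    (prod_le_prod (fun _ _ => (sqPoch_pos (norm_nonneg q) hq _).le) fun _ _ =>
      sqPoch_norm_le hq _)

lemma ofReal_chainTerm (K : ℕ) (r : ℝ) (v N : ℕ → ℕ) :
    ((chainTerm K r v N : ℝ) : ℂ) = chainTerm K (r : ℂ) v N := by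
  simp [chainTerm, sqPoch]

lemma summable_admissible (K a : ℕ) {q : ℂ} (hq : ‖q‖ < 1) :
    Summable fun f : {f // Admissible K a f} => q ^ size f.1 := by
  classical
  refine ((summable_ite_pow_size (p := Admissible K a) hq fun f hf => hf.le).comp_injective
    Subtype.val_injective).congr fun f => ?_
  exact if_pos f.2

lemma hasSum_coeff_partGF (K a : ℕ) {q : ℂ} (hq : ‖q‖ < 1) :
    HasSum (fun m => coeff m (partGF K q a)) (∑' f : {f // Admissible K a f}, q ^ size f.1) := by
  classical
  have h := (summable_admissible K a hq).hasSum.tsum_fiberwise fun f => numParts f.1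
  have hcoeff : (fun m => coeff m (partGF K q a)) = fun m =>
      ∑' f : (fun f : {f // Admissible K a f} => numParts f.1) ⁻¹' {m}, q ^ size f.1.1 := by
    funext m
    rw [partGF, coeff_mk]
    have hinj : Function.Injective
        fun f : (fun f : {f // Admissible K a f} => numParts f.1) ⁻¹' {m} => f.1.1 :=
      Subtype.val_injective.comp Subtype.val_injective
    rw [← hinj.tsum_eq]
    · exact tsum_congr fun f => if_pos ⟨f.1.2, f.2⟩
    · intro f hf
      by_cases h : Admissible K a f ∧ numParts f = m
      · exact ⟨⟨⟨f, h.1⟩, h.2⟩, rfl⟩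
      · exact absurd (if_neg h) hf
  rw [hcoeff]
  exact h

lemma hasSum_chains {K a : ℕ} {q : ℂ} (hq : ‖q‖ < 1) (ha : 1 ≤ a) (haK : a ≤ K + 1) :
    HasSum (fun m => ∑ N ∈ chains K m, chainTerm K q (ladder a) N)
      (∑' f : {f // Admissible K a f}, q ^ size f.1) := by
  have h := hasSum_coeff_partGF K a hq
  have h0 : ladder a 0 = 0 := if_neg (by omega)
  simpa only [partGF_eq_multisum hq haK, multisum, if_pos h0, coeff_mk] using h

lemma summable_chainTerm {K a : ℕ} {q : ℂ} (hq : ‖q‖ < 1) (ha : 1 ≤ a) (haK : a ≤ K + 1) :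
    Summable fun N : {N : Fin K → ℕ // Antitone N} =>
      chainTerm K q (ladder a) (chainOf K N.1) := by
  refine Summable.of_norm_bounded (g := fun N : {N : Fin K → ℕ // Antitone N} =>
    chainTerm K ‖q‖ (ladder a) (chainOf K N.1)) ?_ fun N => norm_chainTerm_le K hq _ _
  rw [← (Equiv.sigmaFiberEquiv fun N : {N : Fin K → ℕ // Antitone N} => ∑ i, N.1 i).summable_iff]
  have hfib := fun m => hasSum_fiber K m fun N => chainTerm K ‖q‖ (ladder a) N
  refine (summable_sigma_of_nonneg fun _ => chainTerm_nonneg K (norm_nonneg q) hq _ _).2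
    ⟨fun m => (hfib m).summable, ?_⟩
  have hq' : ‖((‖q‖ : ℝ) : ℂ)‖ < 1 := by simpa using hq
  refine (Complex.summable_ofReal.1 ?_ : Summable fun m =>
    ∑ N ∈ chains K m, chainTerm K ‖q‖ (ladder a) N).congr fun m => (hfib m).tsum_eq.symm
  simpa only [Complex.ofReal_sum, ofReal_chainTerm] using (hasSum_chains hq' ha haK).summable

lemma tsum_chainTerm {K a : ℕ} {q : ℂ} (hq : ‖q‖ < 1) (ha : 1 ≤ a) (haK : a ≤ K + 1) :
    ∑' N : {N : Fin K → ℕ // Antitone N}, chainTerm K q (ladder a) (chainOf K N.1) =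
      ∑' f : {f // Admissible K a f}, q ^ size f.1 := by
  have h := (summable_chainTerm hq ha haK).hasSum.tsum_fiberwise
    fun N : {N : Fin K → ℕ // Antitone N} => ∑ i, N.1 i
  simp only [fun m => (hasSum_fiber K m fun N => chainTerm K q (ladder a) N).tsum_eq] at h
  exact h.unique (hasSum_chains hq ha haK)

/-- The partition with multiplicities `f`. -/
noncomputable def toPartition {n : ℕ} (f : ℕ →₀ ℕ) (hf : size f = n) : n.Partition where
  parts := Finsupp.toMultiset (f.embDomain (addRightEmbedding 1))
  parts_pos := by
    intro i hi
    rw [Finsupp.mem_toMultiset, Finsupp.support_embDomain, mem_map] at hi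
    obtain ⟨j, -, rfl⟩ := hi
    exact Nat.succ_pos j
  parts_sum := by
    rw [← hf, Finsupp.toMultiset_apply, Finsupp.sum_embDomain, Finsupp.sum, size, Finsupp.sum,
      ← Multiset.coe_sumAddMonoidHom, map_sum]
    simp [Multiset.sum_nsmul]

lemma count_toPartition {n : ℕ} (f : ℕ →₀ ℕ) (hf : size f = n) (i : ℕ) :
    (toPartition f hf).parts.count (i + 1) = f i := by
  rw [toPartition, Finsupp.count_toMultiset]
  exact Finsupp.embDomain_apply_self (addRightEmbedding 1) f i

lemma card_partition {k a : ℕ} (ha : 1 ≤ a) (n : ℕ) :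
    Nat.card {P : n.Partition //
          P.parts.count 1 ≤ a - 1 ∧
          (∀ i : ℕ, 1 ≤ i → P.parts.count i + P.parts.count (i + 1) ≤ k - 1) ∧
          ∀ j : ℕ, 1 ≤ j → Even (P.parts.count (2 * j))} =
      Nat.card ((fun f : {f // Admissible (k - 1) a f} => size f.1) ⁻¹' {n}) := by
  symm
  refine Nat.card_congr (Equiv.ofBijective (fun f => ⟨toPartition f.1.1 f.2, ?_, ?_, ?_⟩) ⟨?_, ?_⟩)
  · exact (count_toPartition f.1.1 f.2 0).trans_le (Nat.le_pred_of_lt f.1.2.1)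
  · intro i hi
    obtain ⟨i, rfl⟩ := Nat.exists_eq_add_of_le' hi
    exact (congrArg₂ (· + ·) (count_toPartition f.1.1 f.2 i)
      (count_toPartition f.1.1 f.2 (i + 1))).trans_le (f.1.2.2.1 i)
  · intro j hj
    obtain ⟨j, rfl⟩ := Nat.exists_eq_add_of_le' hj
    have h := f.1.2.2.2 j
    rwa [← count_toPartition f.1.1 f.2] at h
  · intro f g h
    refine Subtype.ext (Subtype.ext (Finsupp.ext fun i => ?_))
    have h1 : toPartition f.1.1 f.2 = toPartition g.1.1 g.2 := congrArg Subtype.val h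
    exact (count_toPartition f.1.1 f.2 i).symm.trans
      ((congrArg (fun P : n.Partition => P.parts.count (i + 1)) h1).trans
        (count_toPartition g.1.1 g.2 i))
  · rintro ⟨P, h1, h2, h3⟩
    let f : ℕ →₀ ℕ := (Multiset.toFinsupp P.parts).comapDomain (· + 1) (add_left_injective 1).injOn
    have hfi : ∀ i, f i = P.parts.count (i + 1) := fun i => by simp [f]
    have hparts : Finsupp.toMultiset (f.embDomain (addRightEmbedding 1)) = P.parts := by
      ext i
      rw [Finsupp.count_toMultiset]
      match i with
      | 0 =>
        rw [Finsupp.embDomain_of_notMem_range _ _ _ (by simp), Multiset.count_eq_zero_of_notMem]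
        exact fun h => absurd (P.parts_pos h) (lt_irrefl 0)
      | i + 1 => exact (Finsupp.embDomain_apply_self (addRightEmbedding 1) f i).trans (hfi i)
    have hsize : size f = n := by
      rw [← (toPartition f rfl).parts_sum, ← P.parts_sum]
      exact congrArg _ hparts
    refine ⟨⟨⟨f, ?_, fun i => ?_, fun j => ?_⟩, hsize⟩, Subtype.ext (Nat.Partition.ext hparts)⟩
    · rw [hfi]
      exact Nat.lt_of_le_pred ha h1
    · rw [hfi, hfi]
      exact h2 _ (by omega)
    · rw [hfi, show 2 * j + 1 + 1 = 2 * (j + 1) by ring]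
      exact h3 _ (by omega)

lemma hasSum_card_partition {k a : ℕ} (ha : 1 ≤ a) {q : ℂ} (hq : ‖q‖ < 1) :
    HasSum (fun n : ℕ => (Nat.card {P : n.Partition //
          P.parts.count 1 ≤ a - 1 ∧
          (∀ i : ℕ, 1 ≤ i → P.parts.count i + P.parts.count (i + 1) ≤ k - 1) ∧
          ∀ j : ℕ, 1 ≤ j → Even (P.parts.count (2 * j))} : ℂ) * q ^ n)
      (∑' f : {f // Admissible (k - 1) a f}, q ^ size f.1) := by
  have h := (summable_admissible (k - 1) a hq).hasSum.tsum_fiberwise fun f => size f.1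
  have hfib : ∀ n, ∑' f : (fun f : {f // Admissible (k - 1) a f} => size f.1) ⁻¹' {n},
      q ^ size f.1.1 = (Nat.card ((fun f : {f // Admissible (k - 1) a f} => size f.1) ⁻¹' {n}) : ℂ)
        * q ^ n := fun n => by
    rw [← nsmul_eq_mul, ← tsum_const]
    exact tsum_congr fun f => congrArg (q ^ ·) f.2
  simp only [card_partition ha, ← hfib]
  exact h

end Kursungoz

/-- Kurşungöz' multisum generating function for `W_{k,a}(n)` when `k ≢ a (mod 2)`. -/
theorem kursungoz_W_opposite_parity (k a : ℕ) (ha : 1 ≤ a) (hak : a ≤ k)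
    (hpar : k % 2 ≠ a % 2) (q : ℂ) (hq : ‖q‖ < 1) :
    Summable (fun n : ℕ =>
      (Nat.card {P : n.Partition //
          P.parts.count 1 ≤ a - 1 ∧
          (∀ i : ℕ, 1 ≤ i → P.parts.count i + P.parts.count (i + 1) ≤ k - 1) ∧
          ∀ j : ℕ, 1 ≤ j → Even (P.parts.count (2 * j))} : ℂ) * q ^ n) ∧
    Summable (fun N : {N : Fin (k - 1) → ℕ // Antitone N} => kurTerm k a q N.1) ∧
    ∑' n : ℕ,
      (Nat.card {P : n.Partition //
          P.parts.count 1 ≤ a - 1 ∧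
          (∀ i : ℕ, 1 ≤ i → P.parts.count i + P.parts.count (i + 1) ≤ k - 1) ∧
          ∀ j : ℕ, 1 ≤ j → Even (P.parts.count (2 * j))} : ℂ) * q ^ n =
      ∑' N : {N : Fin (k - 1) → ℕ // Antitone N}, kurTerm k a q N.1 := by
  have hterm : (fun N : {N : Fin (k - 1) → ℕ // Antitone N} => kurTerm k a q N.1) = fun N =>
      Kursungoz.chainTerm (k - 1) q (Kursungoz.ladder a) (Kursungoz.chainOf (k - 1) N.1) :=
    funext fun N => Kursungoz.kurTerm_eq_chainTerm k a ha q N.1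
  have hsum := Kursungoz.hasSum_card_partition (k := k) ha hq
  rw [hterm]
  exact ⟨hsum.summable, Kursungoz.summable_chainTerm hq ha (by omega),
    hsum.tsum_eq.trans (Kursungoz.tsum_chainTerm hq ha (by omega)).symm⟩
end

section
/- Let k and a be integers with 2 ≤ k, 1 ≤ a ≤ k, and k ≢ a (mod 2), and let q be a complex number with |q| < 1. Then ∑_{N_1 ≥ N_2 ≥ ⋯ ≥ N_{k−1} ≥ 0} q^{N_1² + N_2² + ⋯ + N_{k−1}² + 2N_a + 2N_{a+2} + ⋯ + 2N_{k−1}} / ((q²;q²)_{N_1−N_2} ⋯ (q²;q²)_{N_{k−2}−N_{k−1}} (q²;q²)_{N_{k−1}}) = (−q³; q²)_∞ (q^{a+1}, q^{2k+1−a}, q^{2k+2}; q^{2k+2})_∞ / (q²; q²)_∞ + q (−q³; q²)_∞ (q^{a−1}, q^{2k+3−a}, q^{2k+2}; q^{2k+2})_∞ / (q²; q²)_∞, where on the left the subscripts a, a+2, …, k−1 increase in steps of 2 and the sum converges absolutely. -/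
open Finset

/-- Infinite q-Pochhammer symbol `(x;q)_∞`. -/
noncomputable def qPochInf (q x : ℂ) : ℂ :=
  ∏' j : ℕ, (1 - x * q ^ j)

lemma qPoch_succ (q x : ℂ) (n : ℕ) :
    qPoch q x (n + 1) = qPoch q x n * (1 - x * q ^ n) :=
  Finset.prod_range_succ _ _

lemma qPoch_add (q x : ℂ) (m n : ℕ) :
    qPoch q x (m + n) = qPoch q x m * qPoch q (x * q ^ m) n := by
  simp only [qPoch, Finset.prod_range_add, pow_add, mul_assoc]

lemma qPoch_succ' (q x : ℂ) (n : ℕ) :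
    qPoch q x (n + 1) = (1 - x) * qPoch q (x * q) n := by
  rw [add_comm, qPoch_add]
  simp [qPoch]

lemma one_sub_pow_ne_zero {q : ℂ} (hq : ‖q‖ < 1) {n : ℕ} (hn : n ≠ 0) : 1 - q ^ n ≠ 0 := by
  intro h
  have h1 : ‖q ^ n‖ = 1 := by rw [← sub_eq_zero.mp h, norm_one]
  rw [norm_pow] at h1
  exact absurd h1 (pow_lt_one₀ (norm_nonneg q) hq hn).ne

lemma qPoch_self_ne_zero {q : ℂ} (hq : ‖q‖ < 1) (n : ℕ) : qPoch q q n ≠ 0 := by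
  refine Finset.prod_ne_zero_iff.mpr fun j _ => ?_
  rw [← pow_succ']
  exact one_sub_pow_ne_zero hq j.succ_ne_zero

/-- `1 / (q;q)_{n-r}`, understood as `0` when `n < r`. -/
noncomputable def qInv (q : ℂ) (n r : ℕ) : ℂ :=
  if r ≤ n then (qPoch q q (n - r))⁻¹ else 0

lemma qInv_of_lt (q : ℂ) {n r : ℕ} (h : n < r) : qInv q n r = 0 := if_neg (by omega)

lemma qInv_zero_right (q : ℂ) (n : ℕ) : qInv q n 0 = (qPoch q q n)⁻¹ := by simp [qInv]

lemma qInv_add_add (q : ℂ) (m n r : ℕ) : qInv q (m + n) (m + r) = qInv q n r := by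
  simp [qInv, Nat.add_sub_add_left]

lemma qInv_succ_succ (q : ℂ) (n r : ℕ) : qInv q (n + 1) (r + 1) = qInv q n r := by
  simp [qInv]

lemma qInv_succ_left {q : ℂ} (hq : ‖q‖ < 1) (n r : ℕ) :
    (1 - q ^ (n + 1 - r)) * qInv q (n + 1) r = qInv q n r := by
  rcases lt_trichotomy r (n + 1) with h | rfl | h
  · obtain ⟨d, rfl⟩ := Nat.exists_eq_add_of_le (Nat.lt_succ_iff.mp h)
    have h1 := qPoch_self_ne_zero hq (d + 1)
    rw [qPoch_succ, ← pow_succ'] at h1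
    have h2 := right_ne_zero_of_mul h1
    rw [add_assoc, Nat.add_sub_cancel_left, ← add_zero r, add_assoc r 0, qInv_add_add,
      add_assoc r 0, qInv_add_add, zero_add, zero_add, qInv_zero_right, qInv_zero_right,
      qPoch_succ, ← pow_succ']
    field_simp
  · simp [qInv]
  · simp [qInv_of_lt _ h, qInv_of_lt q (show n < r by omega)]

lemma qInv_succ_right {q : ℂ} (hq : ‖q‖ < 1) (n r : ℕ) :
    qInv q n (r + 1) = (1 - q ^ (n - r)) * qInv q n r := by
  rw [← qInv_succ_succ q n r, ← qInv_succ_left hq n (r + 1), Nat.add_sub_add_right]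

lemma qInv_succ_zero {q : ℂ} (hq : ‖q‖ < 1) (n : ℕ) :
    (1 - q ^ (n + 1)) * qInv q (n + 1) 0 = qInv q n 0 := by
  simpa using qInv_succ_left hq n 0

lemma sum_qInv_pascal {q : ℂ} (hq : ‖q‖ < 1) (N : ℕ) (f : ℕ → ℂ) :
    (1 - q ^ (N + 1)) * ∑ j ∈ range (N + 2), qInv q (N + 1) j * qInv q j 0 * f j =
      ∑ j ∈ range (N + 1), qInv q N j * qInv q j 0 * (q ^ j * f j + f (j + 1)) := by
  have h : ∀ j ∈ range (N + 2), (1 - q ^ (N + 1)) * (qInv q (N + 1) j * qInv q j 0 * f j) =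
      qInv q N j * qInv q j 0 * (q ^ j * f j) +
        qInv q (N + 1) j * ((1 - q ^ j) * qInv q j 0) * f j := by
    intro j hj
    have hj' : j ≤ N + 1 := by simpa [Nat.lt_succ_iff] using hj
    rw [← qInv_succ_left hq N j]
    have : q ^ (N + 1) = q ^ (N + 1 - j) * q ^ j := by rw [← pow_add]; congr 1; omega
    rw [this]; ring
  rw [mul_sum, sum_congr rfl h, sum_add_distrib, sum_range_succ _ (N + 1),
    qInv_of_lt q (Nat.lt_succ_self N), sum_range_succ' _ (N + 1)]
  simp only [qInv_succ_zero hq, qInv_succ_succ, mul_add, sum_add_distrib]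
  simp

/-- The `q`-Chu–Vandermonde sum, cleared of the denominators `(xy;q)_j`. -/
lemma sum_qVandermonde {q : ℂ} (hq : ‖q‖ < 1) (x : ℂ) (N : ℕ) (y : ℂ) :
    ∑ j ∈ range (N + 1), qInv q N j * qInv q j 0 *
        ((-y) ^ j * q ^ j.choose 2 * qPoch q x j * qPoch q (x * y * q ^ j) (N - j)) =
      qPoch q y N * qInv q N 0 := by
  induction N generalizing y with
  | zero => simp [qInv, qPoch]
  | succ N ih =>
    refine mul_left_cancel₀ (one_sub_pow_ne_zero hq N.succ_ne_zero) ?_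
    rw [Nat.succ_eq_add_one, sum_qInv_pascal hq, qPoch_succ', mul_left_comm,
      qInv_succ_zero hq, mul_assoc, mul_comm y q, mul_comm q y, ← ih (y * q), mul_sum]
    refine sum_congr rfl fun j hj => ?_
    have hj' : j ≤ N := by simpa [Nat.lt_succ_iff] using hj
    have h1 : N + 1 - j = N - j + 1 := by omega
    rw [h1, qPoch_succ', Nat.add_sub_add_right, qPoch_succ, Nat.choose_succ_succ']
    have h2 : x * y * q ^ j * q = x * (y * q) * q ^ j := by ring
    have h3 : x * y * q ^ (j + 1) = x * (y * q) * q ^ j := by ring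
    rw [h2, h3]
    simp only [Nat.choose_one_right, pow_add, neg_mul_eq_neg_mul, mul_pow, pow_one]
    ring

lemma sum_qVandermonde_pow {q : ℂ} (hq : ‖q‖ < 1) {x y : ℂ} {c : ℕ} (h : x * y = q ^ (c + 1))
    (N : ℕ) :
    ∑ j ∈ range (N + 1), qInv q N j * qInv q j 0 *
        ((-y) ^ j * q ^ j.choose 2 * qPoch q x j * qInv q (c + j) 0) =
      qPoch q y N * qInv q N 0 * qInv q (c + N) 0 := by
  rw [← sum_qVandermonde hq x, sum_mul]
  refine sum_congr rfl fun j hj => ?_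
  obtain ⟨d, rfl⟩ := Nat.exists_eq_add_of_le (show j ≤ N by simpa [Nat.lt_succ_iff] using hj)
  rw [h, Nat.add_sub_cancel_left, qInv_zero_right q (c + j), qInv_zero_right q (c + (j + d)),
    ← add_assoc, qPoch_add q q (c + j)]
  have h1 := qPoch_self_ne_zero hq (c + j)
  have h2 : q ^ (c + 1) * q ^ j = q * q ^ (c + j) := by ring
  have h3 : qPoch q (q * q ^ (c + j)) d ≠ 0 := by
    have := qPoch_self_ne_zero hq (c + j + d)
    rw [qPoch_add] at this
    exact right_ne_zero_of_mul this
  rw [h2]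
  field_simp

lemma norm_sq_lt_one {q : ℂ} (hq : ‖q‖ < 1) : ‖q ^ 2‖ < 1 := by
  rw [norm_pow]
  exact pow_lt_one₀ (norm_nonneg q) hq two_ne_zero

/-- The operator `f ↦ ∑_{s ≤ n} q^{s² + e s} f(s) / (q²;q²)_{n-s}`. -/
noncomputable def baileyStep (q : ℂ) (e : ℕ) (f : ℕ → ℂ) (n : ℕ) : ℂ :=
  ∑ s ∈ range (n + 1), q ^ (s ^ 2 + e * s) * qInv (q ^ 2) n s * f s

/-- `(-q;q²)_n / ((q²;q²)_{n-r} (q²;q²)_{n+r})`. -/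
noncomputable def evenKernel (q : ℂ) (r n : ℕ) : ℂ :=
  qPoch (q ^ 2) (-q) n * (qInv (q ^ 2) n r * qInv (q ^ 2) (n + r) 0)

/-- `(-q;q²)_{n+d} / ((q²;q²)_{n-r} (q²;q²)_{n+r+1})`. -/
noncomputable def oddKernel (q : ℂ) (d r n : ℕ) : ℂ :=
  qPoch (q ^ 2) (-q) (n + d) * (qInv (q ^ 2) n r * qInv (q ^ 2) (n + r + 1) 0)

lemma evenKernel_of_lt (q : ℂ) {r n : ℕ} (h : n < r) : evenKernel q r n = 0 := by
  simp [evenKernel, qInv_of_lt _ h]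

lemma oddKernel_of_lt (q : ℂ) (d : ℕ) {r n : ℕ} (h : n < r) : oddKernel q d r n = 0 := by
  simp [oddKernel, qInv_of_lt _ h]

lemma baileyStep_add {q : ℂ} (e r N : ℕ) {f : ℕ → ℂ} (hf : ∀ s < r, f s = 0) :
    baileyStep q e f (r + N) =
      ∑ j ∈ range (N + 1), q ^ ((r + j) ^ 2 + e * (r + j)) * qInv (q ^ 2) N j * f (r + j) := by
  rw [baileyStep, add_assoc, sum_range_add, sum_eq_zero, zero_add]
  · simp only [qInv_add_add]
  · intro s hs
    rw [hf s (mem_range.mp hs), mul_zero]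

lemma baileyStep_of_lt {q : ℂ} (e : ℕ) {r n : ℕ} (h : n < r) {f : ℕ → ℂ}
    (hf : ∀ s < r, f s = 0) : baileyStep q e f n = 0 := by
  refine sum_eq_zero fun s hs => ?_
  rw [hf s (by have := mem_range.mp hs; omega), mul_zero]

lemma sq_pow_choose_two (q : ℂ) (j : ℕ) : (q ^ 2) ^ j.choose 2 * q ^ j = q ^ j ^ 2 := by
  rw [← pow_mul, ← pow_add]
  congr 1
  induction j with
  | zero => rfl
  | succ j ih => rw [Nat.choose_succ_succ', Nat.choose_one_right]; nlinarith

lemma qInv_add_self (q : ℂ) (r j : ℕ) : qInv q (r + j) r = qInv q j 0 := by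
  simpa using qInv_add_add q r j 0

lemma baileyStep_evenKernel {q : ℂ} (hq : ‖q‖ < 1) (r n : ℕ) :
    baileyStep q 0 (evenKernel q r) n = q ^ r ^ 2 * evenKernel q r n := by
  have h0 : ∀ s < r, evenKernel q r s = 0 := fun s hs => evenKernel_of_lt q hs
  rcases lt_or_ge n r with h | h
  · rw [baileyStep_of_lt 0 h h0, evenKernel_of_lt q h, mul_zero]
  obtain ⟨N, rfl⟩ := Nat.exists_eq_add_of_le h
  have key := sum_qVandermonde_pow (norm_sq_lt_one hq) (x := -q * (q ^ 2) ^ r)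
    (y := -q * (q ^ 2) ^ r) (c := 2 * r) (by ring) N
  rw [baileyStep_add 0 r N h0, evenKernel, qPoch_add, qInv_add_self,
    show r + N + r = 2 * r + N by ring]
  trans q ^ r ^ 2 * qPoch (q ^ 2) (-q) r * (qPoch (q ^ 2) (-q * (q ^ 2) ^ r) N *
    qInv (q ^ 2) N 0 * qInv (q ^ 2) (2 * r + N) 0)
  · rw [← key, mul_sum]
    refine sum_congr rfl fun j _ => ?_
    rw [evenKernel, qPoch_add, qInv_add_self, show r + j + r = 2 * r + j by ring,
      show q ^ ((r + j) ^ 2 + 0 * (r + j)) = q ^ r ^ 2 * q ^ (2 * r * j) * q ^ j ^ 2 by ring,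
      ← sq_pow_choose_two q j]
    ring
  · ring

lemma one_add_odd_pow_ne_zero {q : ℂ} (hq : ‖q‖ < 1) (r : ℕ) : 1 + q ^ (2 * r + 1) ≠ 0 := by
  have h := one_sub_pow_ne_zero (q := -q) (by simpa using hq) (Nat.succ_ne_zero (2 * r))
  rwa [Nat.succ_eq_add_one, (odd_two_mul_add_one r).neg_pow, sub_neg_eq_add] at h

lemma baileyStep_oddKernel_zero {q : ℂ} (hq : ‖q‖ < 1) (r n : ℕ) :
    baileyStep q 2 (oddKernel q 0 r) n =
      q ^ (r ^ 2 + 2 * r) / (1 + q ^ (2 * r + 1)) * oddKernel q 1 r n := by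
  have h0 : ∀ s < r, oddKernel q 0 r s = 0 := fun s hs => oddKernel_of_lt q 0 hs
  rcases lt_or_ge n r with h | h
  · rw [baileyStep_of_lt 2 h h0, oddKernel_of_lt q 1 h, mul_zero]
  obtain ⟨N, rfl⟩ := Nat.exists_eq_add_of_le h
  have key := sum_qVandermonde_pow (norm_sq_lt_one hq) (x := -q * (q ^ 2) ^ r)
    (y := -q * (q ^ 2) ^ (r + 1)) (c := 2 * r + 1) (by ring) N
  rw [baileyStep_add 2 r N h0, oddKernel, show r + N + 1 = r + 1 + N by ring, qPoch_add,
    qPoch_succ, qInv_add_self, show r + N + r + 1 = 2 * r + 1 + N by ring]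
  trans q ^ (r ^ 2 + 2 * r) * qPoch (q ^ 2) (-q) r * (qPoch (q ^ 2) (-q * (q ^ 2) ^ (r + 1)) N *
    qInv (q ^ 2) N 0 * qInv (q ^ 2) (2 * r + 1 + N) 0)
  · rw [← key, mul_sum]
    refine sum_congr rfl fun j _ => ?_
    rw [oddKernel, add_zero, qPoch_add, qInv_add_self, show r + j + r + 1 = 2 * r + 1 + j by ring,
      show q ^ ((r + j) ^ 2 + 2 * (r + j)) =
        q ^ (r ^ 2 + 2 * r) * q ^ (2 * (r + 1) * j) * q ^ j ^ 2 by ring, ← sq_pow_choose_two q j]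
    ring
  · have := one_add_odd_pow_ne_zero hq r
    rw [show (1 : ℂ) - -q * (q ^ 2) ^ r = 1 + q ^ (2 * r + 1) by ring]
    field_simp

lemma baileyStep_oddKernel_one {q : ℂ} (hq : ‖q‖ < 1) (r n : ℕ) :
    baileyStep q 0 (oddKernel q 1 r) n =
      q ^ r ^ 2 * (1 + q ^ (2 * r + 1)) * oddKernel q 0 r n := by
  have h0 : ∀ s < r, oddKernel q 1 r s = 0 := fun s hs => oddKernel_of_lt q 1 hs
  rcases lt_or_ge n r with h | h
  · rw [baileyStep_of_lt 0 h h0, oddKernel_of_lt q 0 h, mul_zero]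
  obtain ⟨N, rfl⟩ := Nat.exists_eq_add_of_le h
  have key := sum_qVandermonde_pow (norm_sq_lt_one hq) (x := -q * (q ^ 2) ^ (r + 1))
    (y := -q * (q ^ 2) ^ r) (c := 2 * r + 1) (by ring) N
  rw [baileyStep_add 0 r N h0, oddKernel, add_zero, qPoch_add,
    qInv_add_self, show r + N + r + 1 = 2 * r + 1 + N by ring]
  trans q ^ r ^ 2 * qPoch (q ^ 2) (-q) (r + 1) * (qPoch (q ^ 2) (-q * (q ^ 2) ^ r) N *
    qInv (q ^ 2) N 0 * qInv (q ^ 2) (2 * r + 1 + N) 0)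
  · rw [← key, mul_sum]
    refine sum_congr rfl fun j _ => ?_
    rw [oddKernel, show r + j + 1 = r + 1 + j by ring, qPoch_add, qInv_add_self,
      show r + j + r + 1 = 2 * r + 1 + j by ring,
      show q ^ ((r + j) ^ 2 + 0 * (r + j)) = q ^ r ^ 2 * q ^ (2 * r * j) * q ^ j ^ 2 by ring,
      ← sq_pow_choose_two q j]
    ring
  · rw [qPoch_succ]
    ring

lemma oddKernel_one_eq {q : ℂ} (hq : ‖q‖ < 1) (r n : ℕ) :
    (1 - q ^ (2 * r + 1)) * oddKernel q 1 r n =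
      evenKernel q r n - q ^ (2 * r + 1) * evenKernel q (r + 1) n := by
  rcases lt_or_ge n r with h | h
  · rw [oddKernel_of_lt q 1 h, evenKernel_of_lt q h, evenKernel_of_lt q (h.trans r.lt_succ_self)]
    ring
  obtain ⟨N, rfl⟩ := Nat.exists_eq_add_of_le h
  rw [oddKernel, evenKernel, evenKernel, qInv_succ_right (norm_sq_lt_one hq), ← add_assoc,
    ← qInv_succ_zero (norm_sq_lt_one hq) (r + N + r), Nat.add_sub_cancel_left, qPoch_succ]
  ring

lemma baileyStep_sum {q : ℂ} {e : ℕ} {f C : ℕ → ℂ} {x y : ℕ → ℕ → ℂ}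
    (hx : ∀ r s, s < r → x r s = 0) (hxy : ∀ r n, baileyStep q e (x r) n = y r n)
    (hf : ∀ n, f n = ∑ r ∈ range (n + 1), C r * x r n) (n : ℕ) :
    baileyStep q e f n = ∑ r ∈ range (n + 1), C r * y r n := by
  have h : ∀ s ∈ range (n + 1), f s = ∑ r ∈ range (n + 1), C r * x r s := by
    intro s hs
    rw [hf s]
    refine sum_subset (range_mono (by have := mem_range.mp hs; omega)) fun r _ hr => ?_
    rw [hx r s (by simpa using hr), mul_zero]
  simp only [← hxy, baileyStep]
  rw [sum_congr rfl fun s hs => by rw [h s hs, mul_sum], sum_comm]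
  refine sum_congr rfl fun r _ => ?_
  rw [mul_sum]
  exact sum_congr rfl fun s _ => by ring

lemma sum_unit_expansion {q : ℂ} (hq : ‖q‖ < 1) (n : ℕ) :
    ∑ r ∈ range (n + 1), (-1) ^ r * q ^ r.choose 2 * (1 - q ^ (2 * r + 1)) *
      (qInv q n r * qInv q (n + r + 1) 0) = if n = 0 then 1 else 0 := by
  split_ifs with h
  · subst h
    have := one_sub_pow_ne_zero hq one_ne_zero
    simp only [pow_one] at this
    simp [qInv, qPoch, this]
  · refine (mul_eq_zero.mp ?_).resolve_left (one_sub_pow_ne_zero hq h)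
    let G : ℕ → ℂ := fun r => -((-1) ^ r * q ^ r.choose 2 * (1 - q ^ r) *
      (qInv q n r * qInv q (n + r) 0))
    have hG : ∀ r ∈ range (n + 1), (1 - q ^ n) * ((-1) ^ r * q ^ r.choose 2 *
        (1 - q ^ (2 * r + 1)) * (qInv q n r * qInv q (n + r + 1) 0)) = G (r + 1) - G r := by
      intro r hr
      obtain ⟨N, rfl⟩ := Nat.exists_eq_add_of_le (Nat.lt_succ_iff.mp (mem_range.mp hr))
      simp only [G]
      rw [qInv_succ_right hq, ← add_assoc, ← qInv_succ_zero hq (r + N + r),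
        Nat.add_sub_cancel_left, Nat.choose_succ_succ', Nat.choose_one_right]
      ring
    rw [mul_sum, sum_congr rfl hG, sum_range_sub]
    simp [G, qInv_of_lt q n.lt_succ_self]

lemma qInv_eq_sum_oddKernel {q : ℂ} (hq : ‖q‖ < 1) (n : ℕ) :
    qInv (q ^ 2) n 0 = ∑ r ∈ range (n + 1),
      (-1) ^ r * (q ^ 2) ^ r.choose 2 * (1 - (q ^ 2) ^ (2 * r + 1)) / (1 + q) *
        (q ^ r ^ 2 * (1 + q ^ (2 * r + 1)) * oddKernel q 0 r n) := by
  have h1 : (1 : ℂ) + q ≠ 0 := by simpa using one_add_odd_pow_ne_zero hq 0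
  have hδ : ∀ n : ℕ, (if n = 0 then (1 : ℂ) else 0) = ∑ r ∈ range (n + 1),
      (-1) ^ r * (q ^ 2) ^ r.choose 2 * (1 - (q ^ 2) ^ (2 * r + 1)) / (1 + q) *
        oddKernel q 1 r n := by
    intro n
    trans (qPoch (q ^ 2) (-q) (n + 1) / (1 + q)) * if n = 0 then (1 : ℂ) else 0
    · split_ifs with h
      · subst h
        simp [qPoch, h1]
      · simp
    · rw [← sum_unit_expansion (norm_sq_lt_one hq) n, mul_sum]
      refine sum_congr rfl fun r _ => ?_
      rw [oddKernel]
      ring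
  rw [← baileyStep_sum (fun r s => oddKernel_of_lt q 1) (baileyStep_oddKernel_one hq) hδ n]
  simp [baileyStep]

/-- Iterated operators `baileyStep`, with linear weights `e 0, …, e (m-1)` from the outermost to
the innermost, applied to `1 / (q²;q²)_n`. -/
noncomputable def chainSum (q : ℂ) : ℕ → (ℕ → ℕ) → ℕ → ℂ
  | 0, _ => fun n => qInv (q ^ 2) n 0
  | m + 1, e => baileyStep q (e 0) (chainSum q m fun i => e (i + 1))

lemma chainSum_alternating {q : ℂ} (hq : ‖q‖ < 1) (j : ℕ) {e : ℕ → ℕ}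
    (he : ∀ i < 2 * j + 1, e i = if i % 2 = 0 then 2 else 0) (n : ℕ) :
    chainSum q (2 * j + 1) e n = ∑ r ∈ range (n + 1),
      (-1) ^ r * (q ^ 2) ^ r.choose 2 * (1 - (q ^ 2) ^ (2 * r + 1)) / (1 + q) *
        q ^ (2 * r ^ 2 + 2 * r + j * (2 * r ^ 2 + 2 * r)) * oddKernel q 1 r n := by
  induction j generalizing e n with
  | zero =>
    rw [chainSum, he 0 (by simp), if_pos rfl]
    refine (baileyStep_sum (C := fun r => (-1) ^ r * (q ^ 2) ^ r.choose 2 *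
      (1 - (q ^ 2) ^ (2 * r + 1)) / (1 + q) * (q ^ r ^ 2 * (1 + q ^ (2 * r + 1))))
      (fun r s => oddKernel_of_lt q 0) (baileyStep_oddKernel_zero hq) (fun n => ?_) n).trans ?_
    · simp only [chainSum, qInv_eq_sum_oddKernel hq n, mul_assoc]
    · refine sum_congr rfl fun r _ => ?_
      have := one_add_odd_pow_ne_zero hq r
      field_simp
      ring
  | succ j ih =>
    have h := ih (e := fun i => e (i + 1 + 1)) fun i hi => by
      rw [he _ (by omega)]; simp [add_assoc]
    rw [show 2 * (j + 1) + 1 = 2 * j + 1 + 1 + 1 by ring, chainSum, he 0 (by omega), if_pos rfl]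
    refine (baileyStep_sum (C := fun r => (-1) ^ r * (q ^ 2) ^ r.choose 2 *
      (1 - (q ^ 2) ^ (2 * r + 1)) / (1 + q) * q ^ (2 * r ^ 2 + 2 * r + j * (2 * r ^ 2 + 2 * r)) *
        (q ^ r ^ 2 * (1 + q ^ (2 * r + 1))))
      (fun r s => oddKernel_of_lt q 0) (baileyStep_oddKernel_zero hq) (fun n => ?_) n).trans ?_
    · rw [chainSum, he (0 + 1) (by omega), if_neg (by simp)]
      simpa only [mul_assoc] using baileyStep_sum (fun r s => oddKernel_of_lt q 1)
        (baileyStep_oddKernel_one hq) h n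
    · refine sum_congr rfl fun r _ => ?_
      have := one_add_odd_pow_ne_zero hq r
      field_simp
      ring

lemma chainSum_eq {q : ℂ} (hq : ‖q‖ < 1) (j b : ℕ) {e : ℕ → ℕ} (hb : ∀ i < b, e i = 0)
    (he : ∀ i < 2 * j + 1, e (b + i) = if i % 2 = 0 then 2 else 0) (n : ℕ) :
    chainSum q (b + (2 * j + 1)) e n = ∑ r ∈ range (n + 1),
      (-1) ^ r * q ^ ((3 + 2 * j) * r ^ 2 + (1 + 2 * j) * r) * (1 + q ^ (2 * r + 1)) / (1 + q) *
        (q ^ (b * r ^ 2) * evenKernel q r n -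
          q ^ (2 * r + 1 + b * (r + 1) ^ 2) * evenKernel q (r + 1) n) := by
  induction b generalizing e n with
  | zero =>
    rw [zero_add, chainSum_alternating hq j (by simpa using he)]
    refine sum_congr rfl fun r _ => ?_
    have h := oddKernel_one_eq hq r n
    rw [show q ^ (0 * r ^ 2) * evenKernel q r n -
      q ^ (2 * r + 1 + 0 * (r + 1) ^ 2) * evenKernel q (r + 1) n =
        (1 - q ^ (2 * r + 1)) * oddKernel q 1 r n by rw [h]; ring,
      show q ^ ((3 + 2 * j) * r ^ 2 + (1 + 2 * j) * r) =
        q ^ (r ^ 2) * q ^ (2 * r ^ 2 + j * (2 * r ^ 2 + 2 * r) + r) by ring,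
      ← sq_pow_choose_two q r]
    ring
  | succ b ih =>
    have h := ih (e := fun i => e (i + 1)) (fun i hi => hb _ (by omega)) fun i hi => by
      rw [← he i hi]; congr 1; ring
    rw [show b + 1 + (2 * j + 1) = b + (2 * j + 1) + 1 by ring, chainSum, hb 0 (by omega)]
    refine baileyStep_sum (y := fun r n => q ^ ((b + 1) * r ^ 2) * evenKernel q r n -
      q ^ (2 * r + 1 + (b + 1) * (r + 1) ^ 2) * evenKernel q (r + 1) n)
      (fun r s hs => ?_) (fun r n => ?_) h n
    · rw [evenKernel_of_lt q hs, evenKernel_of_lt q (hs.trans r.lt_succ_self)]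
      ring
    · trans q ^ (b * r ^ 2) * baileyStep q 0 (evenKernel q r) n -
          q ^ (2 * r + 1 + b * (r + 1) ^ 2) * baileyStep q 0 (evenKernel q (r + 1)) n
      · simp only [baileyStep, mul_sum, ← sum_sub_distrib]
        exact sum_congr rfl fun s _ => by ring
      · rw [baileyStep_evenKernel hq, baileyStep_evenKernel hq]
        ring

lemma ext_cons_one (m s : ℕ) (N : Fin m → ℕ) : ext (m + 1) (Fin.cons s N) 1 = s := by
  simp [_root_.ext]

lemma ext_cons_add_two (m s : ℕ) (N : Fin m → ℕ) (i : ℕ) :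
    ext (m + 1) (Fin.cons s N) (i + 1 + 1) = ext m N (i + 1) := by
  unfold _root_.ext
  by_cases h : i < m
  · simp only [Nat.add_sub_cancel, h, Nat.succ_lt_succ h, dite_true]
    exact Fin.cons_succ (α := fun _ => ℕ) s N ⟨i, h⟩
  · simp [h]

/-- The summand of the multisum, extended by `0` to tuples that are not weakly decreasing. -/
noncomputable def chainTerm (q : ℂ) (m : ℕ) (e : ℕ → ℕ) (N : Fin m → ℕ) : ℂ :=
  ∏ i ∈ range m, (q ^ (ext m N (i + 1) ^ 2 + e i * ext m N (i + 1)) *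
    qInv (q ^ 2) (ext m N (i + 1)) (ext m N (i + 1 + 1)))

lemma chainTerm_cons (q : ℂ) (m : ℕ) (e : ℕ → ℕ) (s : ℕ) (N : Fin m → ℕ) :
    chainTerm q (m + 1) e (Fin.cons s N) = q ^ (s ^ 2 + e 0 * s) *
      (qInv (q ^ 2) s (ext m N 1) * chainTerm q m (fun i => e (i + 1)) N) := by
  rw [chainTerm, prod_range_succ']
  simp only [ext_cons_add_two]
  rw [zero_add, ext_cons_one, chainTerm]
  ring

lemma summable_prod_pow_ext {ρ : ℝ} (h0 : 0 ≤ ρ) (h1 : ρ < 1) {C : ℝ} (hC : 0 ≤ C) (m : ℕ) :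
    Summable fun N : Fin m → ℕ => ∏ i ∈ range m, (ρ ^ ext m N (i + 1) * C) := by
  induction m with
  | zero => exact Summable.of_finite
  | succ m ih =>
    rw [← (Fin.consEquiv fun _ : Fin (m + 1) => ℕ).summable_iff]
    have h := ((summable_geometric_of_lt_one h0 h1).mul_right C).mul_of_nonneg ih
      (fun _ => by positivity) (fun _ => prod_nonneg fun _ _ => by positivity)
    refine h.congr fun x => ?_
    simp only [Function.comp_apply, Fin.consEquiv, Equiv.coe_fn_mk, prod_range_succ',
      ext_cons_add_two]
    rw [zero_add, ext_cons_one, mul_comm]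

lemma norm_chainTerm_le {q : ℂ} (hq : ‖q‖ < 1) {C : ℝ} (hC : ∀ n r, ‖qInv (q ^ 2) n r‖ ≤ C)
    (m : ℕ) (e : ℕ → ℕ) (N : Fin m → ℕ) :
    ‖chainTerm q m e N‖ ≤ ∏ i ∈ range m, (‖q‖ ^ ext m N (i + 1) * C) := by
  rw [chainTerm, norm_prod]
  refine prod_le_prod (fun _ _ => norm_nonneg _) fun i _ => ?_
  rw [norm_mul, norm_pow]
  refine mul_le_mul (pow_le_pow_of_le_one (norm_nonneg q) hq.le ?_) (hC _ _) (norm_nonneg _)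
    (by positivity)
  exact (Nat.le_self_pow two_ne_zero _).trans (Nat.le_add_right _ _)

lemma hasSum_of_hasSum_cons {m : ℕ} {F : (Fin (m + 1) → ℕ) → ℂ} {g : ℕ → ℂ} (hF : Summable F)
    (hg : ∀ s, HasSum (fun N : Fin m → ℕ => F (Fin.cons s N)) (g s)) : HasSum g (∑' N, F N) :=
  (((Fin.consEquiv fun _ : Fin (m + 1) => ℕ).hasSum_iff).mpr hF.hasSum).prod_fiberwise hg

lemma hasSum_chainSum {q : ℂ} (hq : ‖q‖ < 1) {C : ℝ} (hC : ∀ n r, ‖qInv (q ^ 2) n r‖ ≤ C)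
    (m : ℕ) (e : ℕ → ℕ) (n : ℕ) :
    HasSum (fun N : Fin m → ℕ => qInv (q ^ 2) n (ext m N 1) * chainTerm q m e N)
      (chainSum q m e n) := by
  have hC0 : 0 ≤ C := (norm_nonneg _).trans (hC 0 0)
  induction m generalizing e n with
  | zero =>
    convert hasSum_fintype (fun N : Fin 0 → ℕ => qInv (q ^ 2) n (ext 0 N 1) * chainTerm q 0 e N)
    simp [chainSum, _root_.ext, chainTerm]
  | succ m ih =>
    have hs : Summable fun N : Fin (m + 1) → ℕ =>
        qInv (q ^ 2) n (ext (m + 1) N 1) * chainTerm q (m + 1) e N := by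
      refine Summable.of_norm_bounded
        ((summable_prod_pow_ext (norm_nonneg q) hq hC0 (m + 1)).mul_left C) fun N => ?_
      rw [norm_mul]
      exact mul_le_mul (hC _ _) (norm_chainTerm_le hq hC _ _ _) (norm_nonneg _) hC0
    have h1 := hasSum_of_hasSum_cons hs (g := fun s => qInv (q ^ 2) n s *
      (q ^ (s ^ 2 + e 0 * s) * chainSum q m (fun i => e (i + 1)) s)) fun s => by
        simp only [ext_cons_one, chainTerm_cons]
        exact ((ih (fun i => e (i + 1)) s).mul_left _).mul_left _
    have h2 : HasSum (fun s => qInv (q ^ 2) n s *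
        (q ^ (s ^ 2 + e 0 * s) * chainSum q m (fun i => e (i + 1)) s))
        (chainSum q (m + 1) e n) := by
      rw [chainSum, baileyStep, sum_congr rfl fun s _ => by rw [mul_comm (q ^ _), mul_assoc]]
      refine hasSum_sum_of_ne_finset_zero fun s hs => ?_
      rw [qInv_of_lt _ (by simpa using hs)]
      ring
    rw [← h1.unique h2]
    exact hs.hasSum

lemma hasSum_pow_mul_chainSum {q : ℂ} (hq : ‖q‖ < 1) {C : ℝ}
    (hC : ∀ n r, ‖qInv (q ^ 2) n r‖ ≤ C) (m : ℕ) (e : ℕ → ℕ) :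
    Summable (chainTerm q (m + 1) e) ∧
      HasSum (fun s => q ^ (s ^ 2 + e 0 * s) * chainSum q m (fun i => e (i + 1)) s)
        (∑' N, chainTerm q (m + 1) e N) := by
  have hs : Summable (chainTerm q (m + 1) e) :=
    Summable.of_norm_bounded (summable_prod_pow_ext (norm_nonneg q) hq
      ((norm_nonneg _).trans (hC 0 0)) (m + 1)) (norm_chainTerm_le hq hC _ _)
  refine ⟨hs, hasSum_of_hasSum_cons hs fun s => ?_⟩
  simp only [chainTerm_cons]
  exact (hasSum_chainSum hq hC m (fun i => e (i + 1)) s).mul_left _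

/-- The terms of index `r` and `-r-1` of the bilateral theta series
`∑ (-1)^n y^n (xy)^{n(n-1)/2}`, grouped together. -/
noncomputable def thetaTerm (x y : ℂ) (r : ℕ) : ℂ :=
  (-1) ^ r * (y ^ r * (x * y) ^ r.choose 2 - x ^ (r + 1) * (x * y) ^ (r + 1).choose 2)

lemma thetaTerm_zero_recurrence (x y : ℂ) (N : ℕ) :
    (1 - x * (x * y) ^ (N + 1)) * (1 - y * (x * y) ^ N) * thetaTerm x y 0 =
      (1 + (x * y) ^ (2 * N + 2)) * thetaTerm x y 0 + (x * y) ^ (N + 1) * thetaTerm x y 0 +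
        (x * y) ^ N * thetaTerm x y 1 := by
  simp only [thetaTerm, Nat.choose_succ_succ', Nat.choose_one_right, Nat.choose_zero_succ,
    Nat.choose_zero_right]
  ring

lemma thetaTerm_succ_recurrence (x y : ℂ) (t N : ℕ) :
    (1 - x * (x * y) ^ (t + 1 + N + 1)) * (1 - y * (x * y) ^ (t + 1 + N)) * thetaTerm x y (t + 1) =
      (1 + (x * y) ^ (2 * (t + 1 + N) + 2)) * thetaTerm x y (t + 1) +
        (x * y) ^ (t + 1 + N + 1 + (t + 1)) * thetaTerm x y t +
        (x * y) ^ N * thetaTerm x y (t + 1 + 1) := by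
  have h (n : ℕ) : (n + 1).choose 2 = n + n.choose 2 := by
    rw [Nat.choose_succ_succ', Nat.choose_one_right]
  simp only [thetaTerm, h]
  ring

/-- `1 / ((q;q)_{n-r} (q;q)_{n+r+1})`. -/
noncomputable def oddInv (q : ℂ) (n r : ℕ) : ℂ := qInv q n r * qInv q (n + r + 1) 0

lemma oddInv_of_lt (q : ℂ) {n r : ℕ} (h : n < r) : oddInv q n r = 0 := by
  simp [oddInv, qInv_of_lt _ h]

lemma oddInv_zero_recurrence {q : ℂ} (hq : ‖q‖ < 1) (n : ℕ) :
    (1 - q ^ (2 * n + 2)) * (1 - q ^ (2 * n + 3)) * oddInv q (n + 1) 0 =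
      (1 + q ^ (2 * n + 2)) * oddInv q n 0 + q ^ (n + 2) * oddInv q n 1 +
        q ^ (n + 1) * oddInv q n 0 := by
  have h1 := qInv_succ_right hq n 0
  have h2 := qInv_succ_left hq n 0
  have h3 := qInv_succ_zero hq (n + 1)
  simp only [zero_add, Nat.sub_zero, add_assoc, Nat.reduceAdd] at h1 h2 h3
  simp only [oddInv, add_zero, add_assoc, Nat.reduceAdd]
  rw [h1, ← h2, ← h3]
  ring

lemma oddInv_succ_recurrence {q : ℂ} (hq : ‖q‖ < 1) (t N : ℕ) :
    (1 - q ^ (2 * (t + N) + 2)) * (1 - q ^ (2 * (t + N) + 3)) * oddInv q (t + N + 1) (t + 1) =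
      (1 + q ^ (2 * (t + N) + 2)) * oddInv q (t + N) (t + 1) +
        q ^ (t + N + 2 + (t + 1)) * oddInv q (t + N) (t + 1 + 1) +
        q ^ N * oddInv q (t + N) t := by
  have h1 : qInv q (t + N) (t + 1 + 1) * q = (q - q ^ N) * qInv q (t + N) (t + 1) := by
    rw [qInv_succ_right hq]
    rcases N with _ | N
    · simp [qInv_of_lt q t.lt_succ_self]
    · rw [show t + (N + 1) - (t + 1) = N by omega]
      ring
  have h2 := qInv_succ_right hq (t + N) t
  rw [Nat.add_sub_cancel_left] at h2
  have h3 := qInv_succ_zero hq (t + N + t + 1)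
  have h4 := qInv_succ_zero hq (t + N + t + 2)
  simp only [oddInv, qInv_succ_succ]
  rw [show t + N + 1 + (t + 1) + 1 = t + N + t + 2 + 1 by ring,
    show t + N + (t + 1) + 1 = t + N + t + 2 by ring,
    show t + N + (t + 1 + 1) + 1 = t + N + t + 2 + 1 by ring, ← h3, ← h4]
  rw [h2] at h1 ⊢
  linear_combination (-q ^ (2 * t + N + 2) * qInv q (t + N + t + 2 + 1) 0) * h1

lemma sum_thetaTerm_succ {x y : ℂ} (hq : ‖x * y‖ < 1) (n : ℕ) :
    (1 - (x * y) ^ (2 * n + 2)) * (1 - (x * y) ^ (2 * n + 3)) *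
        ∑ r ∈ range (n + 2), thetaTerm x y r * oddInv (x * y) (n + 1) r =
      (1 - x * (x * y) ^ (n + 1)) * (1 - y * (x * y) ^ n) *
        ∑ r ∈ range (n + 1), thetaTerm x y r * oddInv (x * y) n r := by
  let G : ℕ → ℂ := fun r => if r = 0 then 0 else
    (x * y) ^ (n + 1 + r) * oddInv (x * y) n r * thetaTerm x y (r - 1) -
      (x * y) ^ (n + 1 - r) * oddInv (x * y) n (r - 1) * thetaTerm x y r
  have hG : ∀ r ∈ range (n + 2),
      (1 - (x * y) ^ (2 * n + 2)) * (1 - (x * y) ^ (2 * n + 3)) *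
          (thetaTerm x y r * oddInv (x * y) (n + 1) r) -
        (1 - x * (x * y) ^ (n + 1)) * (1 - y * (x * y) ^ n) *
          (thetaTerm x y r * oddInv (x * y) n r) = G (r + 1) - G r := by
    intro r hr
    have hr' : r ≤ n + 1 := Nat.lt_succ_iff.mp (mem_range.mp hr)
    rcases r with _ | t
    · have h1 := oddInv_zero_recurrence hq n
      have h2 := thetaTerm_zero_recurrence x y n
      simp only [G, Nat.succ_ne_zero, if_false, if_true, zero_add, Nat.add_sub_cancel,
        Nat.sub_self]
      linear_combination thetaTerm x y 0 * h1 - oddInv (x * y) n 0 * h2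
    · obtain ⟨N, rfl⟩ := Nat.exists_eq_add_of_le (Nat.le_of_succ_le_succ hr')
      have h1 := oddInv_succ_recurrence hq t N
      simp only [G, Nat.succ_ne_zero, if_false, Nat.add_sub_cancel, Nat.add_sub_add_right,
        Nat.add_sub_cancel_left]
      rcases N with _ | N
      · simp only [add_zero, oddInv_of_lt (x * y) t.lt_succ_self] at h1 ⊢
        linear_combination thetaTerm x y (t + 1) * h1
      · have h2 := thetaTerm_succ_recurrence x y t N
        rw [show t + (N + 1) - (t + 1) = N by omega]
        rw [show t + 1 + N = t + (N + 1) by ring] at h2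
        linear_combination thetaTerm x y (t + 1) * h1 - oddInv (x * y) (t + (N + 1)) (t + 1) * h2
  have h := sum_congr rfl hG
  rw [sum_range_sub, sum_sub_distrib, ← mul_sum, ← mul_sum,
    sum_range_succ (fun r => thetaTerm x y r * oddInv (x * y) n r),
    oddInv_of_lt (x * y) n.lt_succ_self] at h
  have h0 : G (n + 2) - G 0 = 0 := by
    simp [G, oddInv_of_lt (x * y) n.lt_succ_self, oddInv_of_lt (x * y) (show n < n + 2 by omega)]
  linear_combination h + h0

/-- A finite form of the Jacobi triple product identity. -/
lemma sum_thetaTerm {x y : ℂ} (hq : ‖x * y‖ < 1) (n : ℕ) :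
    ∑ r ∈ range (n + 1), thetaTerm x y r * oddInv (x * y) n r =
      qPoch (x * y) x (n + 1) * qPoch (x * y) y n * qInv (x * y) (2 * n + 1) 0 := by
  induction n with
  | zero => simp [thetaTerm, oddInv, qInv, qPoch]
  | succ n ih =>
    have h1 := one_sub_pow_ne_zero hq (show 2 * n + 2 ≠ 0 by omega)
    have h2 := one_sub_pow_ne_zero hq (show 2 * n + 3 ≠ 0 by omega)
    refine mul_left_cancel₀ (mul_ne_zero h1 h2) ?_
    rw [sum_thetaTerm_succ hq, ih, qPoch_succ _ x (n + 1), qPoch_succ _ y n,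
      ← qInv_succ_zero hq (2 * n + 1), ← qInv_succ_zero hq (2 * n + 1 + 1),
      show 2 * (n + 1) + 1 = 2 * n + 1 + 1 + 1 by ring]
    ring

open Filter Topology

lemma tendsto_qPoch {q : ℂ} (hq : ‖q‖ < 1) (x : ℂ) :
    Tendsto (qPoch q x) atTop (𝓝 (qPochInf q x)) := by
  have h : Summable fun j : ℕ => ‖-(x * q ^ j)‖ := by
    simp only [norm_neg, norm_mul, norm_pow]
    exact (summable_geometric_of_lt_one (norm_nonneg q) hq).mul_left _
  simpa only [← sub_eq_add_neg] using!
    (multipliable_one_add_of_summable h).hasProd.tendsto_prod_nat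

lemma qPochInf_self_ne_zero {q : ℂ} (hq : ‖q‖ < 1) : qPochInf q q ≠ 0 := by
  have h := tprod_one_add_ne_zero_of_summable (f := fun j : ℕ => -(q * q ^ j)) (fun j => by
    rw [← sub_eq_add_neg, ← pow_succ']
    exact one_sub_pow_ne_zero hq j.succ_ne_zero) (by
    simp only [norm_neg, norm_mul, norm_pow]
    exact (summable_geometric_of_lt_one (norm_nonneg q) hq).mul_left _)
  simpa only [← sub_eq_add_neg] using! h

lemma qPochInf_eq_mul {q : ℂ} (hq : ‖q‖ < 1) (x : ℂ) :
    qPochInf q x = (1 - x) * qPochInf q (x * q) := by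
  refine tendsto_nhds_unique ((tendsto_add_atTop_iff_nat 1).mpr (tendsto_qPoch hq x)) ?_
  simp only [qPoch_succ']
  exact (tendsto_qPoch hq (x * q)).const_mul _

lemma tendsto_qInv {q : ℂ} (hq : ‖q‖ < 1) (r : ℕ) :
    Tendsto (fun n => qInv q n r) atTop (𝓝 (qPochInf q q)⁻¹) := by
  have h := ((tendsto_qPoch hq q).comp (tendsto_sub_atTop_nat r)).inv₀ (qPochInf_self_ne_zero hq)
  refine h.congr' ?_
  filter_upwards [eventually_ge_atTop r] with n hn
  simp [qInv, hn]

lemma exists_norm_le_of_tendsto {f : ℕ → ℂ} {a : ℂ} (h : Tendsto f atTop (𝓝 a)) :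
    ∃ C, ∀ n, ‖f n‖ ≤ C := by
  obtain ⟨C, hC⟩ := isBounded_iff_forall_norm_le.mp (Metric.isBounded_range_of_tendsto f h)
  exact ⟨C, fun n => hC _ (Set.mem_range_self n)⟩

lemma exists_norm_qInv_le {q : ℂ} (hq : ‖q‖ < 1) : ∃ C, ∀ n r, ‖qInv q n r‖ ≤ C := by
  obtain ⟨C, hC⟩ := exists_norm_le_of_tendsto (tendsto_qInv hq 0)
  refine ⟨C, fun n r => ?_⟩
  rcases lt_or_ge n r with h | h
  · rw [qInv_of_lt q h, norm_zero]
    exact (norm_nonneg _).trans (hC 0)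
  · obtain ⟨d, rfl⟩ := Nat.exists_eq_add_of_le h
    rw [qInv_add_self]
    exact hC d

lemma tendsto_sum_range_of_dominated {K : ℕ → ℕ → ℂ} {L : ℕ → ℂ} {bound : ℕ → ℝ}
    (hb : Summable bound) (hK : ∀ r, Tendsto (fun n => K n r) atTop (𝓝 (L r)))
    (h : ∀ n r, ‖K n r‖ ≤ bound r) (h0 : ∀ n r, n < r → K n r = 0) :
    Tendsto (fun n => ∑ r ∈ range (n + 1), K n r) atTop (𝓝 (∑' r, L r)) := by
  refine (tendsto_tsum_of_dominated_convergence hb hK (Eventually.of_forall h)).congr fun n => ?_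
  exact tsum_eq_sum fun r hr => h0 n r (by simpa using hr)

lemma norm_thetaTerm_le {x y : ℂ} (hx : ‖x‖ ≤ 1) (hy : ‖y‖ ≤ 1) (hq : ‖x * y‖ < 1) (r : ℕ) :
    ‖thetaTerm x y r‖ ≤ 2 * ‖x * y‖ ^ (r - 1) := by
  have hc : r - 1 ≤ r.choose 2 := by
    rcases r with _ | r
    · simp
    · rw [Nat.choose_succ_succ', Nat.choose_one_right]; omega
  have hc' : r - 1 ≤ (r + 1).choose 2 := by
    rw [Nat.choose_succ_succ', Nat.choose_one_right]; omega
  have key : ∀ {z : ℂ} {s c : ℕ}, ‖z‖ ≤ 1 → r - 1 ≤ c →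
      ‖z ^ s * (x * y) ^ c‖ ≤ ‖x * y‖ ^ (r - 1) := by
    intro z s c hz hc
    rw [norm_mul, norm_pow, norm_pow]
    calc ‖z‖ ^ s * ‖x * y‖ ^ c ≤ 1 * ‖x * y‖ ^ (r - 1) :=
          mul_le_mul (pow_le_one₀ (norm_nonneg z) hz)
            (pow_le_pow_of_le_one (norm_nonneg _) hq.le hc) (by positivity) zero_le_one
      _ = _ := one_mul _
  rw [thetaTerm, norm_mul, norm_pow, norm_neg, norm_one, one_pow, one_mul, two_mul]
  exact (norm_sub_le _ _).trans (add_le_add (key hy hc) (key hx hc'))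

lemma tendsto_oddInv {q : ℂ} (hq : ‖q‖ < 1) (r : ℕ) :
    Tendsto (fun n => oddInv q n r) atTop (𝓝 ((qPochInf q q)⁻¹ * (qPochInf q q)⁻¹)) := by
  simp only [oddInv, add_assoc]
  have h : Tendsto (fun n => qInv q (n + (r + 1)) 0) atTop (𝓝 (qPochInf q q)⁻¹) :=
    (tendsto_qInv hq 0).comp (tendsto_add_atTop_nat (r + 1))
  exact (tendsto_qInv hq r).mul h

/-- The Jacobi triple product identity. -/
lemma hasSum_thetaTerm {x y : ℂ} (hx : ‖x‖ ≤ 1) (hy : ‖y‖ ≤ 1) (hq : ‖x * y‖ < 1) :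
    HasSum (thetaTerm x y)
      (qPochInf (x * y) x * qPochInf (x * y) y * qPochInf (x * y) (x * y)) := by
  obtain ⟨C, hC⟩ := exists_norm_qInv_le hq
  have hC0 : 0 ≤ C := (norm_nonneg _).trans (hC 0 0)
  have hb : Summable fun r : ℕ => 2 * ‖x * y‖ ^ (r - 1) := by
    refine Summable.mul_left 2
      ((summable_nat_add_iff (f := fun r : ℕ => ‖x * y‖ ^ (r - 1)) 1).mp ?_)
    simp only [Nat.add_sub_cancel]
    exact summable_geometric_of_lt_one (norm_nonneg (x * y)) hq
  have hs : Summable (thetaTerm x y) := Summable.of_norm_bounded hb (norm_thetaTerm_le hx hy hq)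
  have hodd : ∀ r, Tendsto (fun n => thetaTerm x y r * oddInv (x * y) n r) atTop
      (𝓝 (thetaTerm x y r * ((qPochInf (x * y) (x * y))⁻¹ * (qPochInf (x * y) (x * y))⁻¹))) :=
    fun r => (tendsto_oddInv hq r).const_mul _
  have h1 := tendsto_sum_range_of_dominated (hb.mul_right (C * C)) hodd (fun n r => by
    rw [norm_mul, oddInv, norm_mul]
    exact mul_le_mul (norm_thetaTerm_le hx hy hq r)
      (mul_le_mul (hC _ _) (hC _ _) (norm_nonneg _) hC0) (by positivity) (by positivity))
    (fun n r h => by rw [oddInv_of_lt _ h, mul_zero])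
  simp only [sum_thetaTerm hq] at h1
  have h2 : Tendsto (fun n => qInv (x * y) (2 * n + 1) 0) atTop
      (𝓝 (qPochInf (x * y) (x * y))⁻¹) := (tendsto_qInv hq 0).comp
    (tendsto_atTop_mono (fun n : ℕ => show n ≤ 2 * n + 1 by omega) tendsto_id)
  have hx' : Tendsto (fun n => qPoch (x * y) x (n + 1)) atTop (𝓝 (qPochInf (x * y) x)) :=
    (tendsto_qPoch hq x).comp (tendsto_add_atTop_nat 1)
  have h3 := tendsto_nhds_unique h1 ((hx'.mul (tendsto_qPoch hq y)).mul h2)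
  rw [tsum_mul_right] at h3
  have hne := qPochInf_self_ne_zero hq
  field_simp at h3
  rw [mul_comm, ← mul_assoc, ← h3]
  exact hs.hasSum

lemma tendsto_baileyStep {q : ℂ} (hq : ‖q‖ < 1) (e : ℕ) {f : ℕ → ℂ}
    (hf : Summable fun s => q ^ (s ^ 2 + e * s) * f s) :
    Tendsto (baileyStep q e f) atTop
      (𝓝 ((∑' s, q ^ (s ^ 2 + e * s) * f s) * (qPochInf (q ^ 2) (q ^ 2))⁻¹)) := by
  obtain ⟨C, hC⟩ := exists_norm_qInv_le (norm_sq_lt_one hq)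
  rw [← tsum_mul_right]
  refine tendsto_sum_range_of_dominated (hf.norm.mul_right C) (fun s => ?_) (fun n s => ?_)
    (fun n s h => ?_)
  · have h := ((tendsto_qInv (norm_sq_lt_one hq) s).const_mul (q ^ (s ^ 2 + e * s))).mul_const
      (f s)
    rwa [mul_right_comm _ (qPochInf _ _)⁻¹] at h
  · rw [mul_right_comm, norm_mul]
    exact mul_le_mul_of_nonneg_left (hC _ _) (norm_nonneg _)
  · rw [qInv_of_lt _ h]
    ring

lemma tendsto_evenKernel {q : ℂ} (hq : ‖q‖ < 1) (r : ℕ) :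
    Tendsto (evenKernel q r) atTop (𝓝 (qPochInf (q ^ 2) (-q) *
      ((qPochInf (q ^ 2) (q ^ 2))⁻¹ * (qPochInf (q ^ 2) (q ^ 2))⁻¹))) :=
  (tendsto_qPoch (norm_sq_lt_one hq) (-q)).mul ((tendsto_qInv (norm_sq_lt_one hq) r).mul
    ((tendsto_add_atTop_iff_nat r).mpr (tendsto_qInv (norm_sq_lt_one hq) 0)))

lemma exists_norm_evenKernel_le {q : ℂ} (hq : ‖q‖ < 1) :
    ∃ C, ∀ r n, ‖evenKernel q r n‖ ≤ C := by
  obtain ⟨C, hC⟩ := exists_norm_qInv_le (norm_sq_lt_one hq)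
  obtain ⟨D, hD⟩ := exists_norm_le_of_tendsto (tendsto_qPoch (norm_sq_lt_one hq) (-q))
  have hC0 : 0 ≤ C := (norm_nonneg _).trans (hC 0 0)
  have hD0 : 0 ≤ D := (norm_nonneg _).trans (hD 0)
  refine ⟨D * (C * C), fun r n => ?_⟩
  rw [evenKernel, norm_mul, norm_mul]
  exact mul_le_mul (hD n) (mul_le_mul (hC _ _) (hC _ _) (norm_nonneg _) hC0) (by positivity) hD0

lemma tendsto_sum_evenKernel {q : ℂ} (hq : ‖q‖ < 1) (j b : ℕ) :
    Tendsto (fun n => ∑ r ∈ range (n + 1),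
      (-1) ^ r * q ^ ((3 + 2 * j) * r ^ 2 + (1 + 2 * j) * r) * (1 + q ^ (2 * r + 1)) / (1 + q) *
        (q ^ (b * r ^ 2) * evenKernel q r n -
          q ^ (2 * r + 1 + b * (r + 1) ^ 2) * evenKernel q (r + 1) n)) atTop
      (𝓝 (∑' r, (-1) ^ r * q ^ ((3 + 2 * j) * r ^ 2 + (1 + 2 * j) * r) * (1 + q ^ (2 * r + 1)) /
        (1 + q) * (q ^ (b * r ^ 2) * (qPochInf (q ^ 2) (-q) *
            ((qPochInf (q ^ 2) (q ^ 2))⁻¹ * (qPochInf (q ^ 2) (q ^ 2))⁻¹)) -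
          q ^ (2 * r + 1 + b * (r + 1) ^ 2) * (qPochInf (q ^ 2) (-q) *
            ((qPochInf (q ^ 2) (q ^ 2))⁻¹ * (qPochInf (q ^ 2) (q ^ 2))⁻¹))))) := by
  obtain ⟨C, hC⟩ := exists_norm_evenKernel_le hq
  have hC0 : 0 ≤ C := (norm_nonneg _).trans (hC 0 0)
  have hpow : ∀ n, ‖q ^ n‖ ≤ 1 := fun n => by
    rw [norm_pow]; exact pow_le_one₀ (norm_nonneg q) hq.le
  refine tendsto_sum_range_of_dominated (bound := fun r => ‖q‖ ^ r * 2 / ‖1 + q‖ * (C + C))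
    (((summable_geometric_of_lt_one (norm_nonneg q) hq).mul_right 2).div_const _ |>.mul_right _)
    (fun r => ((tendsto_evenKernel hq r).const_mul _ |>.sub
      ((tendsto_evenKernel hq (r + 1)).const_mul _)).const_mul _) (fun n r => ?_)
    (fun n r h => ?_)
  · have hmul : ∀ (n r s : ℕ), ‖q ^ n * evenKernel q r s‖ ≤ C := fun n r s => by
      rw [norm_mul, ← one_mul C]
      exact mul_le_mul (hpow n) (hC _ _) (norm_nonneg _) zero_le_one
    rw [norm_mul, norm_div, norm_mul, norm_mul, norm_pow, norm_neg, norm_one, one_pow, one_mul]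
    have h1 : ‖q ^ ((3 + 2 * j) * r ^ 2 + (1 + 2 * j) * r)‖ ≤ ‖q‖ ^ r := by
      rw [norm_pow]
      exact pow_le_pow_of_le_one (norm_nonneg q) hq.le (by nlinarith)
    have h2 : ‖1 + q ^ (2 * r + 1)‖ ≤ 2 := by
      refine (norm_add_le _ _).trans ?_
      rw [norm_one]
      linarith [hpow (2 * r + 1)]
    have h3 := (norm_sub_le (q ^ (b * r ^ 2) * evenKernel q r n)
      (q ^ (2 * r + 1 + b * (r + 1) ^ 2) * evenKernel q (r + 1) n)).trans
      (add_le_add (hmul _ _ _) (hmul _ _ _))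
    gcongr
  · rw [evenKernel_of_lt q h, evenKernel_of_lt q (h.trans r.lt_succ_self)]
    ring

lemma thetaTerm_add_thetaTerm (q : ℂ) (j b r : ℕ) :
    (-1) ^ r * q ^ ((3 + 2 * j) * r ^ 2 + (1 + 2 * j) * r) * (1 + q ^ (2 * r + 1)) *
        (q ^ (b * r ^ 2) - q ^ (2 * r + 1 + b * (r + 1) ^ 2)) =
      thetaTerm (q ^ (b + 2)) (q ^ (b + 4 + 4 * j)) r +
        q * thetaTerm (q ^ b) (q ^ (b + 6 + 4 * j)) r := by
  have hr : r ^ 2 = 2 * r.choose 2 + r := by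
    induction r with
    | zero => rfl
    | succ r ih => rw [Nat.choose_succ_succ', Nat.choose_one_right]; nlinarith
  rw [show (r + 1) ^ 2 = r ^ 2 + 2 * r + 1 by ring, hr, thetaTerm, thetaTerm,
    Nat.choose_succ_succ', Nat.choose_one_right]
  ring

lemma tsum_chainTerm {q : ℂ} (hq : ‖q‖ < 1) (j b : ℕ) {e : ℕ → ℕ} (hb : ∀ i < b, e i = 0)
    (he : ∀ i < 2 * j + 1, e (b + i) = if i % 2 = 0 then 2 else 0) :
    Summable (chainTerm q (b + (2 * j + 1)) e) ∧ ∑' N, chainTerm q (b + (2 * j + 1)) e N =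
      qPochInf (q ^ 2) (-(q ^ 3)) / qPochInf (q ^ 2) (q ^ 2) *
        ∑' r, (thetaTerm (q ^ (b + 2)) (q ^ (b + 4 + 4 * j)) r +
          q * thetaTerm (q ^ b) (q ^ (b + 6 + 4 * j)) r) := by
  obtain ⟨C, hC⟩ := exists_norm_qInv_le (norm_sq_lt_one hq)
  obtain ⟨hs, h1⟩ := hasSum_pow_mul_chainSum hq hC (b + 2 * j) e
  refine ⟨hs, ?_⟩
  have h2 := tendsto_baileyStep hq (e 0) h1.summable
  rw [h1.tsum_eq] at h2
  have h3 := (tendsto_sum_evenKernel hq j b).congr fun n => (chainSum_eq hq j b hb he n).symm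
  have h4 := tendsto_nhds_unique h2 h3
  have hne := qPochInf_self_ne_zero (norm_sq_lt_one hq)
  have hq1 : 1 + q ≠ 0 := by simpa using one_add_odd_pow_ne_zero hq 0
  have hP : qPochInf (q ^ 2) (-q) = (1 + q) * qPochInf (q ^ 2) (-(q ^ 3)) := by
    rw [qPochInf_eq_mul (norm_sq_lt_one hq) (-q), sub_neg_eq_add, neg_mul, ← pow_succ']
  rw [← div_eq_mul_inv, div_eq_iff hne, ← tsum_mul_right] at h4
  rw [← tsum_mul_left]
  refine h4.trans (tsum_congr fun r => ?_)
  rw [← thetaTerm_add_thetaTerm, hP]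
  field_simp

lemma antitone_of_chainTerm_ne_zero {q : ℂ} {m : ℕ} {e : ℕ → ℕ} {N : Fin m → ℕ}
    (h : chainTerm q m e N ≠ 0) : Antitone N := by
  have hstep : ∀ i < m, ext m N (i + 1 + 1) ≤ ext m N (i + 1) := fun i hi => by
    by_contra hlt
    refine h (prod_eq_zero (mem_range.mpr hi) ?_)
    rw [qInv_of_lt _ (not_le.mp hlt), mul_zero]
  have hanti : Antitone fun i => ext m N (i + 1) := antitone_nat_of_succ_le fun i => by
    rcases lt_or_ge i m with hi | hi
    · exact hstep i hi
    · simp [_root_.ext, show ¬ i + 1 < m by omega]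
  intro i i' hii'
  simpa [_root_.ext] using hanti (Fin.le_def.mp hii')

lemma ext_succ_le {m : ℕ} {N : Fin m → ℕ} (hN : Antitone N) (i : ℕ) :
    ext m N (i + 1 + 1) ≤ ext m N (i + 1) := by
  unfold _root_.ext
  by_cases h : i + 1 < m
  · simp only [Nat.add_sub_cancel, h, i.lt_succ_self.trans h, dite_true]
    exact hN (Fin.le_def.mpr i.le_succ)
  · simp [h]

lemma kurTerm_eq_chainTerm (q : ℂ) {m a : ℕ} (ha : 1 ≤ a) {N : Fin m → ℕ} (hN : Antitone N) :
    kurTerm (m + 1) a q N =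
      chainTerm q m (fun i => if a ≤ i + 1 ∧ (i + 1) % 2 = a % 2 then 2 else 0) N := by
  have hIcc : Icc 1 m = Ico 1 (m + 1) := rfl
  have hfilter : (Icc a m).filter (fun i => i % 2 = a % 2) =
      (Icc 1 m).filter fun i => a ≤ i ∧ i % 2 = a % 2 := by
    ext i
    simp only [mem_filter, mem_Icc]
    omega
  rw [kurTerm, chainTerm]
  change q ^ ((∑ i ∈ Icc 1 m, ext m N i ^ 2) +
    ∑ i ∈ (Icc a m).filter (fun i => i % 2 = a % 2), 2 * ext m N i) /
      ∏ i ∈ Icc 1 m, qPoch (q ^ 2) (q ^ 2) (ext m N i - ext m N (i + 1)) = _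
  rw [hfilter, sum_filter, hIcc, sum_Ico_eq_sum_range, sum_Ico_eq_sum_range,
    prod_Ico_eq_prod_range, ← sum_add_distrib, ← prod_pow_eq_pow_sum, div_eq_mul_inv,
    ← prod_inv_distrib, ← prod_mul_distrib, Nat.add_sub_cancel]
  refine prod_congr rfl fun i _ => ?_
  rw [add_comm 1 i, qInv, if_pos (ext_succ_le hN i), ite_mul, zero_mul]

/-- Kim–Yee's product formula for the multisum in the case `k ≢ a (mod 2)`. -/
theorem kim_yee_opposite_parity (k a : ℕ) (hk : 2 ≤ k) (ha : 1 ≤ a) (hak : a ≤ k)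
    (hpar : k % 2 ≠ a % 2) (q : ℂ) (hq : ‖q‖ < 1) :
    Summable (fun N : {N : Fin (k - 1) → ℕ // Antitone N} => kurTerm k a q N.1) ∧
    ∑' N : {N : Fin (k - 1) → ℕ // Antitone N}, kurTerm k a q N.1 =
      qPochInf (q ^ 2) (-(q ^ 3)) * qPochInf (q ^ (2 * k + 2)) (q ^ (a + 1)) *
          qPochInf (q ^ (2 * k + 2)) (q ^ (2 * k + 1 - a)) *
          qPochInf (q ^ (2 * k + 2)) (q ^ (2 * k + 2)) / qPochInf (q ^ 2) (q ^ 2) +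
        q * qPochInf (q ^ 2) (-(q ^ 3)) * qPochInf (q ^ (2 * k + 2)) (q ^ (a - 1)) *
          qPochInf (q ^ (2 * k + 2)) (q ^ (2 * k + 3 - a)) *
          qPochInf (q ^ (2 * k + 2)) (q ^ (2 * k + 2)) / qPochInf (q ^ 2) (q ^ 2) := by
  obtain ⟨b, rfl⟩ := Nat.exists_eq_add_of_le' ha
  obtain ⟨j, rfl⟩ : ∃ j, k = b + (2 * j + 1) + 1 := ⟨(k - b - 2) / 2, by omega⟩
  obtain ⟨hs, ht⟩ := tsum_chainTerm hq j b
    (e := fun i => if b + 1 ≤ i + 1 ∧ (i + 1) % 2 = (b + 1) % 2 then 2 else 0)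
    (fun i hi => if_neg (by omega)) (fun i _ => if_congr (by omega) rfl rfl)
  have hpow : ∀ n, ‖q ^ n‖ ≤ 1 := fun n => by
    rw [norm_pow]; exact pow_le_one₀ (norm_nonneg q) hq.le
  have hlt : ‖q ^ (2 * (b + (2 * j + 1) + 1) + 2)‖ < 1 := by
    rw [norm_pow]; exact pow_lt_one₀ (norm_nonneg q) hq (by omega)
  have h1 : q ^ (b + 2) * q ^ (b + 4 + 4 * j) = q ^ (2 * (b + (2 * j + 1) + 1) + 2) := by ring
  have h2 : q ^ b * q ^ (b + 6 + 4 * j) = q ^ (2 * (b + (2 * j + 1) + 1) + 2) := by ring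
  have hθ₁ := hasSum_thetaTerm (hpow (b + 2)) (hpow (b + 4 + 4 * j)) (h1 ▸ hlt)
  have hθ₂ := hasSum_thetaTerm (hpow b) (hpow (b + 6 + 4 * j)) (h2 ▸ hlt)
  rw [h1] at hθ₁
  rw [h2] at hθ₂
  rw [(hθ₁.add (hθ₂.mul_left q)).tsum_eq] at ht
  have hsum := (hasSum_subtype_iff_of_support_subset (s := {N | Antitone N})
    fun N hN => antitone_of_chainTerm_ne_zero hN).mpr (ht ▸ hs.hasSum)
  have hkur : (fun N : {N : Fin (b + (2 * j + 1)) → ℕ // Antitone N} =>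
      kurTerm (b + (2 * j + 1) + 1) (b + 1) q N.1) = chainTerm q (b + (2 * j + 1))
        (fun i => if b + 1 ≤ i + 1 ∧ (i + 1) % 2 = (b + 1) % 2 then 2 else 0) ∘ Subtype.val :=
    funext fun N => kurTerm_eq_chainTerm q ha N.2
  have key := hkur ▸ hsum
  refine ⟨key.summable, key.tsum_eq.trans ?_⟩
  rw [show 2 * (b + (2 * j + 1) + 1) + 1 - (b + 1) = b + 4 + 4 * j by omega,
    show 2 * (b + (2 * j + 1) + 1) + 3 - (b + 1) = b + 6 + 4 * j by omega, Nat.add_sub_cancel,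
    add_assoc b 1 1]
  ring
end
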